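/- arXiv:2602.04610 — 5 statements merged into one kernel-verified Lean document; each statement's English description precedes it below -/
import Mathlib

section
/- Let M be a relational Fraïssé structure with strong amalgamation. Then the following are equivalent: (i) M has the infinite sunflower property; (ii) M has the infinite 2-sunflower property; (iii) for every colouring χ : M → ℕ there is a copy of M in M on which χ is constant or a copy of M in M on which χ is injective; (iv) M has the galah property; (v) M is locally replicable. -/
open FirstOrder FirstOrder.Language Set CategoryTheory

universe u v w x

section Defs

variable (L : FirstOrder.Language.{u, v}) (M : Type w) [L.Structure M]

/-- `X ⊆ M` contains a copy of `M`: there is a substructure of `M` with domain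
contained in `X` that is isomorphic to `M`. -/
def ContainsCopy (X : Set M) : Prop :=
  ∃ S : L.Substructure M, (S : Set M) ⊆ X ∧ Nonempty (S ≃[L] M)

/-- The induced substructure on `C` is isomorphic to `M`. -/
def IsCopy (C : Set M) : Prop :=
  ∃ S : L.Substructure M, (S : Set M) = C ∧ Nonempty (S ≃[L] M)

/-- The galah property: for every partition `(C, Cᶜ)` of the domain of `M`, either the
induced substructure on `C` is isomorphic to `M`, or `Cᶜ` contains a copy of `M`. -/
def GalahProperty : Prop := ∀ C : Set M, IsCopy L M C ∨ ContainsCopy L M Cᶜ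

/-- Indivisibility: for every partition `(C, Cᶜ)` of the domain of `M`, one of the two
parts contains a copy of `M`. -/
def Indivisible : Prop := ∀ C : Set M, ContainsCopy L M C ∨ ContainsCopy L M Cᶜ

/-- `v` and `b` realize the same quantifier-free type over the parameter set `A`. -/
def SameQfTypeOver (A : Set M) (v b : M) : Prop :=
  ∀ (n : ℕ) (φ : L.Formula (Fin (n + 1))), φ.IsQF →
    ∀ g : Fin n → M, (∀ i, g i ∈ A) →
      (φ.Realize (Fin.cons v g) ↔ φ.Realize (Fin.cons b g))

/-- Local replicability: every basic open set
`{v : M | qftp(v / A) = qftp(b / A)}`, for `A` a finite substructure of `M` and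
`b ∈ M \\ A`, contains a copy of `M`. -/
def LocallyReplicable : Prop :=
  ∀ A : L.Substructure M, (A : Set M).Finite → ∀ b : M, b ∉ (A : Set M) →
    ContainsCopy L M {v : M | SameQfTypeOver L M (A : Set M) v b}

/-- The infinite `k`-sunflower property: every structure on `k`-sets isomorphic to `M`
contains an induced substructure isomorphic to `M` whose domain is a sunflower. -/
def InfiniteKSunflowerProperty (k : ℕ) : Prop :=
  ∀ (α : Type x) (X : Set (Finset α)), (∀ v ∈ X, v.card = k) →
    ∀ [L.Structure ↥X], Nonempty (M ≃[L] ↥X) →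
      ∃ (f : M ↪[L] ↥X) (c : Set α),
        ∀ a b : M, a ≠ b →
          ((f a : Finset α) : Set α) ∩ ((f b : Finset α) : Set α) = c

/-- The infinite sunflower property: the infinite `k`-sunflower property for all `k ≥ 1`. -/
def InfiniteSunflowerProperty : Prop :=
  ∀ k : ℕ, 1 ≤ k → InfiniteKSunflowerProperty.{u, v, w, x} L M k

/-- A class of structures has strong amalgamation if any two embeddings from a common
structure can be amalgamated so that the images of the two structures intersect exactly
in the image of the common structure. -/
def HasStrongAmalgamation (K : Set (Bundled.{w} L.Structure)) : Prop :=
  ∀ A B₀ B₁ : Bundled.{w} L.Structure, A ∈ K → B₀ ∈ K → B₁ ∈ K →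
    ∀ (f₀ : A ↪[L] B₀) (f₁ : A ↪[L] B₁),
      ∃ C : Bundled.{w} L.Structure, C ∈ K ∧
        ∃ (g₀ : B₀ ↪[L] C) (g₁ : B₁ ↪[L] C),
          g₀.comp f₀ = g₁.comp f₁ ∧
          Set.range g₀ ∩ Set.range g₁ = Set.range (g₀.comp f₀)

end Defs

section Copies

variable {L : FirstOrder.Language.{u, v}} {M : Type w} [L.Structure M]

/-- The orbit of `b` under the automorphisms of `M` fixing `A` pointwise. -/
def fixingOrbit (L : FirstOrder.Language.{u, v}) {M : Type w} [L.Structure M]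
    (A : Set M) (b : M) : Set M :=
  {v | ∃ σ : M ≃[L] M, (∀ a ∈ A, σ a = a) ∧ σ b = v}

theorem containsCopy_iff_exists_embedding {X : Set M} :
    ContainsCopy L M X ↔ ∃ e : M ↪[L] M, ∀ m, e m ∈ X := by
  constructor
  · rintro ⟨S, hS, ⟨f⟩⟩
    exact ⟨S.subtype.comp f.symm.toEmbedding, fun m => hS (f.symm m).2⟩
  · rintro ⟨e, he⟩
    refine ⟨e.toHom.range, ?_, ⟨e.equivRange.symm⟩⟩
    rintro _ ⟨m, rfl⟩
    exact he m

theorem ContainsCopy.mono {X Y : Set M} (h : ContainsCopy L M X) (hXY : X ⊆ Y) :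
    ContainsCopy L M Y :=
  let ⟨S, hS, hf⟩ := h
  ⟨S, hS.trans hXY, hf⟩

/-- Two embeddings of a finitely generated structure into an ultrahomogeneous one differ by an
automorphism. -/
theorem FirstOrder.Language.IsUltrahomogeneous.exists_equiv_apply_eq
    (hM : L.IsUltrahomogeneous M) {N : Type*} [L.Structure N] (hN : Structure.FG L N)
    (i f : N ↪[L] M) : ∃ σ : M ≃[L] M, ∀ n, σ (i n) = f n := by
  obtain ⟨σ, hσ⟩ := hM i.toHom.range (hN.range i.toHom) (f.comp i.equivRange.symm.toEmbedding)
  refine ⟨σ, fun n => ?_⟩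
  have h := DFunLike.congr_fun hσ (i.equivRange n)
  simpa using h.symm

theorem structure_fg_closure {s : Set M} (hs : s.Finite) :
    Structure.FG L (Substructure.closure L s) :=
  (Substructure.fg_iff_structure_fg _).1 (Substructure.fg_closure hs)

theorem FirstOrder.Language.IsUltrahomogeneous.exists_equiv_eqOn
    (hM : L.IsUltrahomogeneous M) {s : Set M} (hs : s.Finite) (e : M ↪[L] M) :
    ∃ σ : M ≃[L] M, ∀ a ∈ s, σ a = e a := by
  obtain ⟨σ, hσ⟩ := hM.exists_equiv_apply_eq (structure_fg_closure hs)
    (Substructure.closure L s).subtype (e.comp (Substructure.closure L s).subtype)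
  exact ⟨σ, fun a ha => hσ ⟨a, Substructure.subset_closure ha⟩⟩

theorem GalahProperty.indivisible (h : GalahProperty L M) : Indivisible L M := fun C =>
  (h C).imp_left fun ⟨S, hS, hf⟩ => ⟨S, hS.le, hf⟩

theorem Indivisible.containsCopy_or (h : Indivisible L M) {X Y : Set M}
    (hXY : ContainsCopy L M (X ∪ Y)) : ContainsCopy L M X ∨ ContainsCopy L M Y := by
  simp only [containsCopy_iff_exists_embedding] at hXY ⊢
  obtain ⟨e, he⟩ := hXY
  refine (h (e ⁻¹' X)).imp (fun hX => ?_) (fun hX => ?_) <;>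
  · obtain ⟨e', he'⟩ := containsCopy_iff_exists_embedding.1 hX
    refine ⟨e.comp e', fun m => ?_⟩
    have := he (e' m)
    have := he' m
    simp_all

theorem Indivisible.exists_containsCopy_of_biUnion [Nonempty M] (h : Indivisible L M)
    {ι : Type*} (D : ι → Set M) (s : Finset ι) (hs : ContainsCopy L M (⋃ i ∈ s, D i)) :
    ∃ i ∈ s, ContainsCopy L M (D i) := by
  classical
  induction s using Finset.induction_on with
  | empty =>
    obtain ⟨e, he⟩ := containsCopy_iff_exists_embedding.1 hs
    simpa using he (Classical.arbitrary M)
  | insert i s _ ih =>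
    rw [Finset.set_biUnion_insert] at hs
    rcases h.containsCopy_or hs with hi | hs
    · exact ⟨i, Finset.mem_insert_self _ _, hi⟩
    · obtain ⟨j, hj, hD⟩ := ih hs
      exact ⟨j, Finset.mem_insert_of_mem hj, hD⟩

/-- Sequences may be built one term at a time. -/
theorem exists_seq_of_forall_extend {α : Type*} [Nonempty α] (Q : ℕ → (ℕ → α) → Prop)
    (hcongr : ∀ n f g, (∀ i < n, f i = g i) → Q n f → Q n g) (h0 : ∀ f, Q 0 f)
    (hstep : ∀ n f, Q n f → ∃ v, Q (n + 1) (Function.update f n v)) :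
    ∃ f, ∀ n, Q n f := by
  choose! v hv using hstep
  let F : ℕ → ℕ → α := fun n => Nat.rec (fun _ => Classical.arbitrary α)
    (fun n f => Function.update f n (v n f)) n
  have hsucc (n : ℕ) : F (n + 1) = Function.update (F n) n (v n (F n)) := rfl
  have hQ (n : ℕ) : Q n (F n) := by
    induction n with
    | zero => exact h0 _
    | succ n ih => exact hsucc n ▸ hv n _ ih
  have hstable (i n : ℕ) (hin : i < n) : F n i = F (i + 1) i := by
    induction n, hin using Nat.le_induction with
    | base => rfl
    | succ n hin ih => rw [hsucc, Function.update_of_ne (by omega), ih]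
  exact ⟨fun i => F (i + 1) i, fun n => hcongr n (F n) _ (hstable · n) (hQ n)⟩

/-- A colouring `χ` is encoded by the pairs `{m, χ m}`: a sunflower of such pairs is
heterochromatic if its core is empty and monochromatic otherwise. -/
theorem InfiniteKSunflowerProperty.exists_embedding_constant_or_injective [Countable M]
    (h : InfiniteKSunflowerProperty.{u, v, w, x} L M 2) (χ : M → ℕ) :
    ∃ e : M ↪[L] M, (∀ a b, χ (e a) = χ (e b)) ∨ Function.Injective (χ ∘ e) := by
  classical
  obtain ⟨ι, hι⟩ := exists_injective_nat M
  let pair : M → Finset (ULift.{x} (ℕ ⊕ ℕ)) := fun m => {⟨.inl (ι m)⟩, ⟨.inr (χ m)⟩}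
  have hpair : Function.Injective pair := by
    intro a b hab
    have : (⟨.inl (ι a)⟩ : ULift.{x} (ℕ ⊕ ℕ)) ∈ pair b := hab ▸ by simp [pair]
    apply hι
    simpa [pair] using this
  let E : M ≃ Set.range pair := Equiv.ofInjective pair hpair
  let _ : L.Structure (Set.range pair) := E.inducedStructure
  obtain ⟨f, c, hc⟩ := h _ (Set.range pair) (by rintro _ ⟨m, rfl⟩; simp [pair])
    ⟨E.inducedStructureEquiv⟩
  let e : M ↪[L] M := E.inducedStructureEquiv.symm.toEmbedding.comp f
  have he (m : M) : (f m : Finset (ULift.{x} (ℕ ⊕ ℕ))) = pair (e m) :=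
    congrArg Subtype.val (E.apply_symm_apply (f m)).symm
  simp only [he] at hc
  refine ⟨e, ?_⟩
  rcases Set.eq_empty_or_nonempty c with rfl | ⟨y, hy⟩
  · right
    intro a b hab
    by_contra hne
    have : (⟨.inr (χ (e a))⟩ : ULift.{x} (ℕ ⊕ ℕ)) ∈ (∅ : Set _) := by
      rw [← hc a b hne]
      have : χ (e a) = χ (e b) := hab
      simp [pair, this]
    exact this
  · left
    intro a b
    by_cases hne : a = b
    · rw [hne]
    · rw [← hc a b hne] at hy
      have hne' : ι (e a) ≠ ι (e b) := hι.ne (e.injective.ne hne)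
      simp only [pair, Finset.coe_insert, Finset.coe_singleton, Set.mem_inter_iff,
        Set.mem_insert_iff, Set.mem_singleton_iff] at hy
      obtain ⟨rfl | rfl, h' | h'⟩ := hy <;> simp_all

theorem exists_substructure_constant_or_injOn_iff (χ : M → ℕ) :
    ((∃ S : L.Substructure M, Nonempty (S ≃[L] M) ∧ ∀ a ∈ S, ∀ b ∈ S, χ a = χ b) ∨
      ∃ S : L.Substructure M, Nonempty (S ≃[L] M) ∧ Set.InjOn χ (S : Set M)) ↔
    ∃ e : M ↪[L] M, (∀ a b, χ (e a) = χ (e b)) ∨ Function.Injective (χ ∘ e) := by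
  constructor
  · rintro (⟨S, ⟨f⟩, hS⟩ | ⟨S, ⟨f⟩, hS⟩) <;>
      refine ⟨S.subtype.comp f.symm.toEmbedding, ?_⟩
    · exact Or.inl fun a b => hS _ (f.symm a).2 _ (f.symm b).2
    · exact Or.inr fun a b hab =>
        f.symm.injective (Subtype.ext (hS (f.symm a).2 (f.symm b).2 hab))
  · rintro ⟨e, he | he⟩
    · refine Or.inl ⟨e.toHom.range, ⟨e.equivRange.symm⟩, ?_⟩
      rintro _ ⟨a, rfl⟩ _ ⟨b, rfl⟩
      exact he a b
    · refine Or.inr ⟨e.toHom.range, ⟨e.equivRange.symm⟩, ?_⟩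
      rintro _ ⟨a, rfl⟩ _ ⟨b, rfl⟩ hab
      exact congrArg e (he hab)

variable [L.IsRelational]

/-- A map which is locally given by automorphisms is an embedding. -/
theorem exists_embedding_of_locally_equiv {f : M → M}
    (hf : ∀ s : Set M, s.Finite → ∃ σ : M ≃[L] M, ∀ a ∈ s, σ a = f a) :
    ∃ e : M ↪[L] M, ∀ a, e a = f a := by
  refine ⟨{ toFun := f, inj' := ?_, map_fun' := fun g => isEmptyElim g, map_rel' := ?_ },
    fun _ => rfl⟩
  · intro a b hab
    obtain ⟨σ, hσ⟩ := hf {a, b} (by simp)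
    apply σ.injective
    rw [hσ a (by simp), hσ b (by simp), hab]
  · intro n R x
    obtain ⟨σ, hσ⟩ := hf (Set.range x) (Set.finite_range x)
    have : f ∘ x = σ ∘ x := funext fun i => (hσ _ ⟨i, rfl⟩).symm
    change Structure.RelMap R (f ∘ x) ↔ _
    rw [this]
    exact σ.map_rel R x

theorem sameQfTypeOver_iff_mem_fixingOrbit (hM : L.IsUltrahomogeneous M) {A : Set M}
    (hA : A.Finite) {b v : M} (hb : b ∉ A) :
    SameQfTypeOver L M A v b ↔ v ∈ fixingOrbit L A b := by
  classical
  constructor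
  · intro h
    have : Finite A := hA
    obtain ⟨m, ⟨g⟩⟩ := Finite.exists_equiv_fin A
    have hgA (i : Fin m) : ((g.symm i : A) : M) ∈ A := (g.symm i).2
    have hvA : v ∉ A := by
      intro hv
      have := (h m ((Term.var 0).equal (Term.var (g ⟨v, hv⟩).succ))
        (BoundedFormula.IsAtomic.equal _ _).isQF (fun i => g.symm i) hgA).1 (by simp)
      simp only [Formula.realize_equal, Term.realize_var, Fin.cons_zero, Fin.cons_succ,
        Equiv.symm_apply_apply] at this
      exact hb (this ▸ hv)
    let B := Substructure.closure L (insert b A)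
    have hB (x : B) (hx : (x : M) ≠ b) : (x : M) ∈ A := by
      have := x.2
      simp only [B, Substructure.mem_closure_iff_of_isRelational] at this
      exact this.resolve_left hx
    let f : B ↪[L] M :=
      { toFun := fun x => if (x : M) = b then v else x
        inj' := by
          intro x y hxy
          apply Subtype.ext
          by_cases hx : (x : M) = b <;> by_cases hy : (y : M) = b
          · rw [hx, hy]
          · exact absurd (hB y hy) (by simp only [hx, hy, if_true, if_false] at hxy; rwa [← hxy])
          · exact absurd (hB x hx) (by simp only [hx, hy, if_true, if_false] at hxy; rwa [hxy])
          · simpa [hx, hy] using hxy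
        map_fun' := fun g => isEmptyElim g
        map_rel' := by
          intro n R x
          let idx : Fin n → Fin (m + 1) := fun i =>
            if hx : (x i : M) = b then 0 else (g ⟨x i, hB _ hx⟩).succ
          have key := h m (R.formula fun i => Term.var (idx i))
            (BoundedFormula.IsAtomic.rel _ _).isQF (fun i => g.symm i) hgA
          simp only [Formula.realize_rel, Term.realize_var] at key
          convert key using 2
          · funext i
            by_cases hx : (x i : M) = b <;> simp [idx, hx]
          · change Structure.RelMap R (fun i => (x i : M)) ↔ _
            apply iff_of_eq
            congr 1
            funext i
            by_cases hx : (x i : M) = b <;> simp [idx, hx] }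
    obtain ⟨σ, hσ⟩ := hM.exists_equiv_apply_eq (structure_fg_closure (hA.insert b)) B.subtype f
    refine ⟨σ, fun a ha => ?_, ?_⟩
    · have hab : a ≠ b := fun h => hb (h ▸ ha)
      exact (hσ ⟨a, Substructure.subset_closure (Set.mem_insert_of_mem _ ha)⟩).trans (if_neg hab)
    · exact (hσ ⟨b, Substructure.subset_closure (Set.mem_insert _ _)⟩).trans (if_pos rfl)
  · rintro ⟨σ, hσ, rfl⟩ n φ - g hg
    have : (Fin.cons (σ b) g : Fin (n + 1) → M) = σ ∘ (Fin.cons b g : Fin (n + 1) → M) := by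
      funext i
      refine Fin.cases (by simp) (fun j => ?_) i
      simp [hσ _ (hg j)]
    rw [this]
    exact StrongHomClass.realize_formula σ φ

theorem locallyReplicable_iff_containsCopy_fixingOrbit (hM : L.IsUltrahomogeneous M) :
    LocallyReplicable L M ↔
      ∀ A : Set M, A.Finite → ∀ b ∉ A, ContainsCopy L M (fixingOrbit L A b) := by
  have key {A : Set M} (hA : A.Finite) {b : M} (hb : b ∉ A) :
      {v | SameQfTypeOver L M A v b} = fixingOrbit L A b :=
    Set.ext fun _ => sameQfTypeOver_iff_mem_fixingOrbit hM hA hb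
  constructor
  · intro h A hA b hb
    have := h (Substructure.closure L A)
    simp only [Substructure.closure_eq_of_isRelational] at this
    simpa only [key hA hb] using this hA b hb
  · intro h A hA b hb
    rw [key hA hb]
    exact h A hA b hb

/-- Strong amalgamation makes the orbits over finite sets infinite. -/
theorem infinite_fixingOrbit (hM : L.IsUltrahomogeneous M)
    (hSA : HasStrongAmalgamation L (L.age M)) {A : Set M} (hA : A.Finite) {b : M} (hb : b ∉ A) :
    (fixingOrbit L A b).Infinite := by
  intro hfin
  let U := fixingOrbit L A b
  let S := Substructure.closure L A
  let B₀ := Substructure.closure L (insert b A)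
  let B₁ := Substructure.closure L (A ∪ U)
  have h₀ : S ≤ B₀ := Substructure.closure_mono (Set.subset_insert _ _)
  have h₁ : S ≤ B₁ := Substructure.closure_mono Set.subset_union_left
  have hS : Structure.FG L S := structure_fg_closure hA
  have hB₀ : Structure.FG L B₀ := structure_fg_closure (hA.insert b)
  have hB₁ : Structure.FG L B₁ := structure_fg_closure (hA.union hfin)
  obtain ⟨C, ⟨-, ⟨k⟩⟩, g₀, g₁, hg, hrange⟩ := hSA ⟨S, inferInstance⟩ ⟨B₀, inferInstance⟩
    ⟨B₁, inferInstance⟩ ⟨hS, ⟨S.subtype⟩⟩ ⟨hB₀, ⟨B₀.subtype⟩⟩ ⟨hB₁, ⟨B₁.subtype⟩⟩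
    (Substructure.inclusion h₀) (Substructure.inclusion h₁)
  obtain ⟨σ, hσ⟩ := hM.exists_equiv_apply_eq hB₁ B₁.subtype (k.comp g₁)
  obtain ⟨τ, hτ⟩ := hM.exists_equiv_apply_eq hB₀ B₀.subtype
    (σ.symm.toEmbedding.comp (k.comp g₀))
  let b' : B₀ := ⟨b, Substructure.subset_closure (Set.mem_insert _ _)⟩
  have hmem : τ b ∈ U := by
    refine ⟨τ, fun a ha => ?_, rfl⟩
    let a' : S := ⟨a, Substructure.subset_closure ha⟩
    have e₀ := hτ (Substructure.inclusion h₀ a')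
    have e₁ := hσ (Substructure.inclusion h₁ a')
    have e := DFunLike.congr_fun hg a'
    have e₂ : k (g₀ (Substructure.inclusion h₀ a')) = k (g₁ (Substructure.inclusion h₁ a')) :=
      congrArg k e
    refine e₀.trans ?_
    change σ.symm (k (g₀ (Substructure.inclusion h₀ a'))) = a
    rw [e₂]
    exact (congrArg σ.symm e₁.symm).trans (σ.symm_apply_apply a)
  let y : B₁ := ⟨τ b, Substructure.subset_closure (Or.inr hmem)⟩
  have hy : g₁ y = g₀ b' := by
    apply k.injective
    refine (hσ y).symm.trans ?_
    change σ (τ b) = _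
    rw [show τ b = σ.symm (k (g₀ b')) from hτ b']
    exact σ.apply_symm_apply _
  have : g₀ b' ∈ Set.range (g₀.comp (Substructure.inclusion h₀)) :=
    hrange ▸ ⟨⟨b', rfl⟩, ⟨y, hy⟩⟩
  obtain ⟨a, ha⟩ := this
  have hab : Substructure.inclusion h₀ a = b' := g₀.injective ha
  have : (a : M) = b := congrArg Subtype.val hab
  have haA := a.2
  simp only [S, Substructure.mem_closure_iff_of_isRelational] at haA
  exact hb (this ▸ haA)

/-- A subset meeting all the orbits over its finite subsets induces a copy of `M`. -/
theorem isCopy_of_forall_fixingOrbit [Countable M] (hM : L.IsUltrahomogeneous M) {C : Set M}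
    (hC : ∀ A ⊆ C, A.Finite → ∀ b ∉ A, ∃ v ∈ C, v ∈ fixingOrbit L A b) : IsCopy L M C := by
  let S := Substructure.closure L C
  have hSC : (S : Set M) = C := Substructure.closure_eq_of_isRelational L C
  have hSM : L.IsExtensionPair S M := by
    rw [isExtensionPair_iff_exists_embedding_closure_singleton_sup]
    intro T hT f m
    obtain ⟨σ, hσ⟩ := hM.exists_equiv_apply_eq ((Substructure.fg_iff_structure_fg _).1 hT)
      (S.subtype.comp T.subtype) f
    refine ⟨σ.toEmbedding.comp (S.subtype.comp (Substructure.subtype _)), ?_⟩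
    ext t
    exact (hσ t).symm
  have hMS : L.IsExtensionPair M S := by
    rw [isExtensionPair_iff_exists_embedding_closure_singleton_sup]
    intro T hT f m
    obtain ⟨σ, hσ⟩ := hM.exists_equiv_apply_eq ((Substructure.fg_iff_structure_fg _).1 hT)
      T.subtype (S.subtype.comp f)
    have hσS (t : M) (ht : t ∈ T) : σ t ∈ S := by
      have := hσ ⟨t, ht⟩
      simp only [Substructure.coe_subtype, Embedding.comp_apply] at this
      rw [this]
      exact (f _).2
    have hTfin : (T : Set M).Finite := hT.finite
    obtain ⟨τ, hτ, hτm⟩ : ∃ τ : M ≃[L] M, (∀ t ∈ T, τ t = σ t) ∧ τ m ∈ S := by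
      by_cases hm : m ∈ T
      · exact ⟨σ, fun _ _ => rfl, hσS m hm⟩
      · obtain ⟨_, hvC, ρ, hρ, rfl⟩ := hC (σ '' T)
          (by rintro _ ⟨t, ht, rfl⟩; exact hSC ▸ hσS t ht) (hTfin.image σ) (σ m)
          (by rintro ⟨t, ht, h⟩; exact hm (σ.injective h ▸ ht))
        exact ⟨ρ.comp σ, fun t ht => hρ _ ⟨t, ht, rfl⟩, by rwa [← SetLike.mem_coe, hSC]⟩
    refine ⟨Embedding.codRestrict S (τ.toEmbedding.comp (Substructure.subtype _)) ?_, ?_⟩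
    · intro x
      obtain ⟨x, hx⟩ := x
      change τ x ∈ S
      rw [← Substructure.closure_eq T, ← Substructure.closure_union,
        Substructure.mem_closure_iff_of_isRelational] at hx
      rcases hx with hx | hx
      · rw [Set.mem_singleton_iff.1 hx]
        exact hτm
      · rw [hτ _ hx]
        exact hσS _ hx
    · ext t
      exact (hσ t).symm.trans (hτ _ t.2).symm
  let g : L.FGEquiv S M :=
    ⟨S.subtype.toPartialEquiv.domRestrict (A := ⊥) bot_le, Substructure.fg_bot⟩
  obtain ⟨f, -⟩ := equiv_between_cg Structure.cg_of_countable Structure.cg_of_countable g hSM hMS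
  exact ⟨S, hSC, ⟨f⟩⟩

theorem LocallyReplicable.galahProperty [Countable M] (hM : L.IsUltrahomogeneous M)
    (h : LocallyReplicable L M) : GalahProperty L M := by
  rw [locallyReplicable_iff_containsCopy_fixingOrbit hM] at h
  intro C
  by_cases hC : ∀ A ⊆ C, A.Finite → ∀ b ∉ A, ∃ v ∈ C, v ∈ fixingOrbit L A b
  · exact Or.inl (isCopy_of_forall_fixingOrbit hM hC)
  · push Not at hC
    obtain ⟨A, -, hA, b, hb, hAb⟩ := hC
    exact Or.inr ((h A hA b hb).mono fun v hv hvC => hAb v hvC hv)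

theorem GalahProperty.locallyReplicable (hM : L.IsUltrahomogeneous M)
    (h : GalahProperty L M) : LocallyReplicable L M := by
  rw [locallyReplicable_iff_containsCopy_fixingOrbit hM]
  intro A hA b hb
  rcases h (fixingOrbit L A b)ᶜ with ⟨S, hS, ⟨f⟩⟩ | h
  · exfalso
    have hAS (a : M) (ha : a ∈ A) : a ∈ S := by
      rw [← SetLike.mem_coe, hS]
      rintro ⟨σ, hσ, hσb⟩
      exact hb (σ.injective (hσb.trans (hσ a ha).symm) ▸ ha)
    have hSA : Substructure.closure L A ≤ S := Substructure.closure_le.2 hAS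
    let e : M ↪[L] M := S.subtype.comp f.symm.toEmbedding
    obtain ⟨ρ, hρ⟩ := hM.exists_equiv_apply_eq (structure_fg_closure hA)
      (Substructure.closure L A).subtype
      (f.toEmbedding.comp (Substructure.inclusion hSA))
    obtain ⟨σ, hσ⟩ := hM.exists_equiv_eqOn ((hA.insert b).image ρ) e
    have hmem : e (ρ b) ∈ fixingOrbit L A b := by
      refine ⟨σ.comp ρ, fun a ha => ?_, hσ _ ⟨b, Set.mem_insert _ _, rfl⟩⟩
      have h₁ : ρ a = f ⟨a, hAS a ha⟩ := hρ ⟨a, Substructure.subset_closure ha⟩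
      refine (hσ _ ⟨a, Set.mem_insert_of_mem _ ha, rfl⟩).trans ?_
      rw [h₁]
      exact congrArg Subtype.val (f.symm_apply_apply _)
    have : e (ρ b) ∈ (S : Set M) := (f.symm (ρ b)).2
    rw [hS] at this
    exact this hmem
  · rwa [compl_compl] at h

/-- If every orbit over a finite set contains a point related to all of that set, then some copy
of `M` consists of pairwise related points. -/
theorem exists_embedding_pairwise [Countable M] [Infinite M] {r : M → M → Prop}
    (hr : ∀ a b, r a b → r b a)
    (h : ∀ A : Set M, A.Finite → ∀ b ∉ A, ∃ v ∈ fixingOrbit L A b, ∀ a ∈ A, r a v) :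
    ∃ e : M ↪[L] M, ∀ a b, a ≠ b → r (e a) (e b) := by
  obtain ⟨m⟩ : Nonempty (ℕ ≃ M) := nonempty_equiv_of_countable
  obtain ⟨f, hf⟩ := exists_seq_of_forall_extend
    (fun n (f : ℕ → M) => (∃ σ : M ≃[L] M, ∀ i < n, σ (m i) = f i) ∧
      ∀ j < n, ∀ i < j, r (f i) (f j))
    (by
      rintro n f g hfg ⟨⟨σ, hσ⟩, hrf⟩
      refine ⟨⟨σ, fun i hi => (hσ i hi).trans (hfg i hi)⟩, fun j hj i hij => ?_⟩
      rw [← hfg i (hij.trans hj), ← hfg j hj]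
      exact hrf j hj i hij)
    (fun f => ⟨⟨FirstOrder.Language.Equiv.refl L M, by simp⟩, by simp⟩)
    (by
      rintro n f ⟨⟨σ, hσ⟩, hrf⟩
      obtain ⟨_, ⟨τ, hτ, rfl⟩, hv⟩ := h (f '' Set.Iio n) ((Set.finite_Iio n).image f) (σ (m n))
        (by
          rintro ⟨i, hi, hfi⟩
          rw [← hσ i hi] at hfi
          exact absurd (m.injective (σ.injective hfi)) (ne_of_lt hi))
      refine ⟨τ (σ (m n)), ⟨τ.comp σ, fun i hi => ?_⟩, fun j hj i hij => ?_⟩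
      · rcases Nat.lt_succ_iff_lt_or_eq.1 hi with hi | rfl
        · simp [Function.update_of_ne hi.ne, hσ i hi, hτ (f i) ⟨i, hi, rfl⟩]
        · simp
      · rcases Nat.lt_succ_iff_lt_or_eq.1 hj with hj | rfl
        · rw [Function.update_of_ne hj.ne, Function.update_of_ne (hij.trans hj).ne]
          exact hrf j hj i hij
        · rw [Function.update_self, Function.update_of_ne hij.ne]
          exact hv _ ⟨i, hij, rfl⟩)
  obtain ⟨e, he⟩ := exists_embedding_of_locally_equiv (L := L) (f := f ∘ m.symm) (by
    intro s hs
    obtain ⟨n, hn⟩ := (hs.image m.symm).bddAbove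
    obtain ⟨σ, hσ⟩ := (hf (n + 1)).1
    refine ⟨σ, fun a ha => ?_⟩
    simpa using hσ (m.symm a) (Nat.lt_succ_of_le (hn ⟨a, ha, rfl⟩)))
  refine ⟨e, fun a b hab => ?_⟩
  rw [he, he]
  rcases lt_or_gt_of_ne (m.symm.injective.ne hab) with hlt | hlt
  · exact (hf _).2 _ (Nat.lt_succ_self _) _ hlt
  · exact hr _ _ ((hf _).2 _ (Nat.lt_succ_self _) _ hlt)

theorem LocallyReplicable.exists_sunflower [Countable M] [Infinite M]
    (hM : L.IsUltrahomogeneous M) (h : LocallyReplicable L M) {α : Type*} (k : ℕ)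
    (F : M → Finset α) (hF : ∀ m, (F m).card ≤ k) :
    ∃ (e : M ↪[L] M) (c : Set α), ∀ a b, a ≠ b → (F (e a) : Set α) ∩ F (e b) = c := by
  classical
  induction k generalizing F with
  | zero =>
    refine ⟨Embedding.refl L M, ∅, fun a b _ => ?_⟩
    simp [Finset.card_eq_zero.1 (Nat.le_zero.1 (hF a))]
  | succ k ih =>
    by_cases hx : ∃ x, ContainsCopy L M {m | x ∈ F m}
    · obtain ⟨x, hx⟩ := hx
      obtain ⟨e, he⟩ := containsCopy_iff_exists_embedding.1 hx
      obtain ⟨e', c, hc⟩ := ih (fun m => (F (e m)).erase x) (fun m => by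
        rw [Finset.card_erase_of_mem (he m)]
        exact Nat.sub_le_of_le_add (hF _))
      refine ⟨e.comp e', insert x c, fun a b hab => ?_⟩
      rw [← hc a b hab]
      ext y
      by_cases hy : y = x
      · subst hy
        simpa using ⟨he (e' a), he (e' b)⟩
      · simp [hy]
    · have hind := (h.galahProperty hM).indivisible
      rw [locallyReplicable_iff_containsCopy_fixingOrbit hM] at h
      obtain ⟨e, he⟩ := exists_embedding_pairwise (L := L)
        (r := fun a b => Disjoint (F a) (F b)) (fun _ _ hab => hab.symm) (by
          intro A hA b hb
          by_contra! hcon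
          obtain ⟨x, -, hxD⟩ := hind.exists_containsCopy_of_biUnion (fun x => {m | x ∈ F m})
            (hA.toFinset.biUnion F) ((h A hA b hb).mono (fun v hv => by
              obtain ⟨a, ha, hav⟩ := hcon v hv
              obtain ⟨x, hxa, hxv⟩ := Finset.not_disjoint_iff.1 hav
              simp only [Set.mem_iUnion]
              exact ⟨x, Finset.mem_biUnion.2 ⟨a, hA.mem_toFinset.2 ha, hxa⟩, hxv⟩))
          exact hx ⟨x, hxD⟩)
      refine ⟨e, ∅, fun a b hab => ?_⟩
      exact Set.disjoint_iff_inter_eq_empty.1 (Finset.disjoint_coe.2 (he a b hab))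

theorem LocallyReplicable.infiniteSunflowerProperty [Countable M] [Infinite M]
    (hM : L.IsUltrahomogeneous M) (h : LocallyReplicable L M) :
    InfiniteSunflowerProperty.{u, v, w, x} L M := by
  rintro k - α X hX _ ⟨i⟩
  obtain ⟨e, c, hc⟩ := h.exists_sunflower hM k (fun m => (i m : Finset α))
    (fun m => (hX _ (i m).2).le)
  exact ⟨i.toEmbedding.comp e, c, hc⟩

/-- Colour `v` by the first copy of `A` over which `v` realizes the type of `b` over `A`. -/
theorem locallyReplicable_of_forall_colouring [Countable M] (hM : L.IsUltrahomogeneous M)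
    (hSA : HasStrongAmalgamation L (L.age M))
    (h : ∀ χ : M → ℕ, ∃ e : M ↪[L] M,
      (∀ a b, χ (e a) = χ (e b)) ∨ Function.Injective (χ ∘ e)) :
    LocallyReplicable L M := by
  rw [locallyReplicable_iff_containsCopy_fixingOrbit hM]
  intro A hA b hb
  have : Finite A := hA
  obtain ⟨ι, hι⟩ := exists_injective_nat (A → M)
  let U : (A → M) → Set M := fun p => {v | ∃ σ : M ≃[L] M, (∀ a : A, σ a = p a) ∧ σ b = v}
  let colours : M → Set ℕ := fun v => {n | ∃ p, ι p + 1 = n ∧ v ∈ U p}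
  have mem_U (e : M ↪[L] M) {v : M} (hv : v ∈ fixingOrbit L A b) : e v ∈ U fun a => e a := by
    obtain ⟨τ, hτ, rfl⟩ := hv
    obtain ⟨ρ, hρ⟩ := hM.exists_equiv_eqOn (hA.insert (τ b)) e
    refine ⟨ρ.comp τ, fun a => ?_, hρ _ (Set.mem_insert _ _)⟩
    simp [hτ a a.2, hρ a (Set.mem_insert_of_mem _ a.2)]
  obtain ⟨e, he | he⟩ := h fun v => sInf (colours v)
  · have hb₀ : b ∈ fixingOrbit L A b := ⟨FirstOrder.Language.Equiv.refl L M, fun _ _ => rfl, rfl⟩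
    obtain ⟨p, hp, σ, hσ, -⟩ := Nat.sInf_mem (s := colours (e b)) ⟨_, _, rfl, mem_U e hb₀⟩
    refine containsCopy_iff_exists_embedding.2 ⟨σ.symm.toEmbedding.comp e, fun m => ?_⟩
    have hm : sInf (colours (e m)) = ι p + 1 := (he m b).trans hp.symm
    obtain ⟨q, hq, τ, hτ, hτb⟩ :=
      Nat.sInf_mem (s := colours (e m)) (Nat.nonempty_of_pos_sInf (by omega))
    obtain rfl : q = p := hι (Nat.succ_injective (hq.trans hm))
    refine ⟨σ.symm.comp τ, fun a ha => ?_, ?_⟩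
    · have : τ a = σ a := (hτ ⟨a, ha⟩).trans (hσ ⟨a, ha⟩).symm
      simp [this]
    · simp [hτb]
  · refine absurd ((Set.finite_Iic (ι (fun a => e a) + 1)).subset ?_)
      ((infinite_fixingOrbit hM hSA hA hb).image he.injOn)
    rintro _ ⟨v, hv, rfl⟩
    exact Nat.sInf_le ⟨_, rfl, mem_U e hv⟩

end Copies

/-- Theorem (characterisation of the infinite sunflower property): for a relational
Fraïssé structure `M` with strong amalgamation, the following are equivalent:
(i) the infinite sunflower property; (ii) the infinite 2-sunflower property;
(iii) every colouring `χ : M → ℕ` admits a monochromatic or a heterochromatic copy of `M`;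
(iv) the galah property; (v) local replicability. -/
theorem statement0 (L : FirstOrder.Language.{u, v}) [L.IsRelational]
    (M : Type w) [L.Structure M] [Countable M] [Infinite M]
    (hM : L.IsUltrahomogeneous M)
    (hSA : HasStrongAmalgamation L (L.age M)) :
    List.TFAE
      [InfiniteSunflowerProperty.{u, v, w, x} L M,
       InfiniteKSunflowerProperty.{u, v, w, x} L M 2,
       ∀ χ : M → ℕ,
         (∃ S : L.Substructure M, Nonempty (S ≃[L] M) ∧
            ∀ a ∈ S, ∀ b ∈ S, χ a = χ b) ∨
         (∃ S : L.Substructure M, Nonempty (S ≃[L] M) ∧ Set.InjOn χ (S : Set M)),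
       GalahProperty L M,
       LocallyReplicable L M] := by
  tfae_have 1 → 2 := fun h => h 2 one_le_two
  tfae_have 2 → 3 := fun h χ =>
    (exists_substructure_constant_or_injOn_iff χ).2 (h.exists_embedding_constant_or_injective χ)
  tfae_have 3 → 5 := fun h => locallyReplicable_of_forall_colouring hM hSA fun χ =>
    (exists_substructure_constant_or_injOn_iff χ).1 (h χ)
  tfae_have 5 → 4 := fun h => h.galahProperty hM
  tfae_have 4 → 5 := fun h => h.locallyReplicable hM
  tfae_have 5 → 1 := fun h => h.infiniteSunflowerProperty hM
  tfae_finish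
end

section
/- Let P be a countable ultrahomogeneous partial order whose age is the class of all finite partial orders (the generic poset). Then P is locally replicable: for every finite subset A of P and every b ∈ P \ A, the set U = {v ∈ P \ A : for all a ∈ A, (a < v ↔ a < b) and (v < a ↔ b < a)} contains a subset which, with the order inherited from P, is order-isomorphic to P. Consequently, P has the infinite sunflower property. -/
universe u x

namespace GenericPoset

/-- Every isomorphism between finite suborders extends to an automorphism. -/
def Ultrahomogeneous (P : Type u) [PartialOrder P] : Prop :=
  ∀ A B : Set P, A.Finite → B.Finite →
    ∀ e : ↥A ≃o ↥B, ∃ g : P ≃o P, ∀ a : ↥A, g ↑a = ↑(e a)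

/-- Every finite partial order embeds into `P`. -/
def FiniteUniversal (P : Type u) [PartialOrder P] : Prop :=
  ∀ (Q : Type u) [PartialOrder Q] [Fintype Q], Nonempty (Q ↪o P)

/-- The points outside `A` that realize the same order type over `A` as `b`. -/
def basicOpen {P : Type u} [PartialOrder P] (A : Set P) (b : P) : Set P :=
  {v : P | v ∉ A ∧ ∀ a ∈ A, (a < v ↔ a < b) ∧ (v < a ↔ b < a)}

/-- `B` contains an order-isomorphic copy of `P`. -/
def ContainsCopy {P : Type u} [PartialOrder P] (B : Set P) : Prop :=
  ∃ f : P ↪o P, ∀ p, f p ∈ B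

/-- If finite sequences whose pairs `i < j` satisfy `Q i · j ·` can always be prolonged, then
there is an infinite such sequence. -/
theorem exists_seq_of_forall_prolong {α : Type*} [Nonempty α] (B : Set α)
    (Q : ℕ → α → ℕ → α → Prop)
    (prolong : ∀ (n : ℕ) (s : ℕ → α), (∀ i < n, s i ∈ B) →
      (∀ j < n, ∀ i < j, Q i (s i) j (s j)) → ∃ y ∈ B, ∀ i < n, Q i (s i) n y) :
    ∃ s : ℕ → α, (∀ i, s i ∈ B) ∧ ∀ j, ∀ i < j, Q i (s i) j (s j) := by
  choose! y hyB hyQ using prolong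
  let approx : ℕ → ℕ → α := fun n => Nat.rec (fun _ => Classical.arbitrary α)
    (fun n t => Function.update t n (y n t)) n
  have approx_succ (n : ℕ) : approx (n + 1) = Function.update (approx n) n (y n (approx n)) := rfl
  have approx_eq (i n : ℕ) (h : i < n) : approx n i = y i (approx i) := by
    induction n with
    | zero => omega
    | succ n ih =>
      rw [approx_succ]
      rcases Nat.lt_succ_iff_lt_or_eq.mp h with h | rfl
      · rw [Function.update_of_ne h.ne, ih h]
      · rw [Function.update_self]
  have good (n : ℕ) : y n (approx n) ∈ B ∧ ∀ i < n, Q i (y i (approx i)) n (y n (approx n)) := by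
    induction n using Nat.strong_induction_on with
    | _ n ih =>
      have hB : ∀ i < n, approx n i ∈ B := fun i hi => by
        rw [approx_eq i n hi]; exact (ih i hi).1
      have hQ : ∀ j < n, ∀ i < j, Q i (approx n i) j (approx n j) := fun j hj i hi => by
        rw [approx_eq i n (hi.trans hj), approx_eq j n hj]; exact (ih j hj).2 i hi
      refine ⟨hyB n _ hB hQ, fun i hi => ?_⟩
      have := hyQ n _ hB hQ i hi
      rwa [approx_eq i n hi] at this
  exact ⟨fun n => y n (approx n), fun n => (good n).1, fun j => (good j).2⟩

section

variable {P : Type u} [PartialOrder P]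

/-- Ultrahomogeneity for finite families instead of finite subsets. -/
theorem Ultrahomogeneous.exists_orderIso_apply_eq (ultra : Ultrahomogeneous P) {ι : Type*}
    [Finite ι] (s t : ι → P) (h : ∀ i j, s i ≤ s j ↔ t i ≤ t j) :
    ∃ g : P ≃o P, ∀ i, g (s i) = t i := by
  have eq_of_eq {i j : ι} (hij : s i = s j) : t i = t j :=
    le_antisymm ((h i j).mp hij.le) ((h j i).mp hij.ge)
  choose idx hidx using fun x : Set.range s => x.2
  let e : Set.range s ↪o Set.range t :=
    OrderEmbedding.ofMapLEIff (fun x => ⟨t (idx x), Set.mem_range_self _⟩) fun x y => by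
      rw [← Subtype.coe_le_coe, ← Subtype.coe_le_coe, ← h, hidx, hidx]
  have he (i : ι) : e ⟨s i, Set.mem_range_self i⟩ = ⟨t i, Set.mem_range_self i⟩ :=
    Subtype.ext (eq_of_eq (hidx _))
  have surj : Function.Surjective e := by
    rintro ⟨_, i, rfl⟩
    exact ⟨_, he i⟩
  obtain ⟨g, hg⟩ := ultra _ _ (Set.finite_range s) (Set.finite_range t)
    (RelIso.ofSurjective e surj)
  refine ⟨g, fun i => (hg ⟨s i, Set.mem_range_self i⟩).trans ?_⟩
  exact congrArg Subtype.val (he i)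

/-- A countable order `R` embeds into `P` with prescribed restrictions on the image, provided
that each type over a finite set of admissible points has an admissible realization. -/
theorem exists_orderEmbedding_of_forall_realize (ultra : Ultrahomogeneous P)
    (age : FiniteUniversal P) (R : Type u) [PartialOrder R] [Countable R] [Infinite R]
    (B : Set P) (r : P → P → Prop)
    (realize : ∀ A : Set P, A.Finite → A ⊆ B → ∀ b ∉ A,
      ∃ v ∈ basicOpen A b, v ∈ B ∧ ∀ a ∈ A, r a v) :
    ∃ f : R ↪o P, (∀ p, f p ∈ B) ∧ ∀ p q, p ≠ q → r (f p) (f q) ∨ r (f q) (f p) := by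
  classical
  obtain ⟨_⟩ := nonempty_denumerable R
  let p : ℕ ≃ R := (Denumerable.eqv R).symm
  obtain ⟨e₀⟩ := age PUnit
  have : Nonempty P := ⟨e₀ PUnit.unit⟩
  obtain ⟨s, hsB, hs⟩ := exists_seq_of_forall_prolong B
    (fun i x j y => (x ≤ y ↔ p i ≤ p j) ∧ (y ≤ x ↔ p j ≤ p i) ∧ r x y) (by
      intro n s hB hs
      obtain ⟨e⟩ := age ((Finset.range (n + 1)).image p)
      have mem (i : ℕ) (hi : i ≤ n) : p i ∈ (Finset.range (n + 1)).image p :=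
        Finset.mem_image_of_mem _ (by simpa [Nat.lt_succ_iff] using hi)
      obtain ⟨g, hg⟩ := ultra.exists_orderIso_apply_eq
        (fun i : Fin n => e ⟨p i, mem i i.2.le⟩) (fun i => s i) (by
          intro i j
          rw [e.le_iff_le, Subtype.mk_le_mk]
          rcases lt_trichotomy i j with hij | rfl | hij
          · exact (hs j j.2 i hij).1.symm
          · simp
          · exact (hs i i.2 j hij).2.1.symm)
      let b : P := g (e ⟨p n, mem n le_rfl⟩)
      have lt_b (i : ℕ) (hi : i < n) : s i < b ↔ p i < p n := by
        rw [← hg ⟨i, hi⟩, g.lt_iff_lt, e.lt_iff_lt, Subtype.mk_lt_mk]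
      have b_lt (i : ℕ) (hi : i < n) : b < s i ↔ p n < p i := by
        rw [← hg ⟨i, hi⟩, g.lt_iff_lt, e.lt_iff_lt, Subtype.mk_lt_mk]
      have b_ne (i : ℕ) (hi : i < n) : s i ≠ b := by
        rw [← hg ⟨i, hi⟩]
        intro h
        have := p.injective (congrArg Subtype.val (e.injective (g.injective h)))
        exact hi.ne this
      obtain ⟨v, ⟨hvA, hv⟩, hvB, hvr⟩ := realize (s '' Set.Iio n) ((Set.finite_Iio n).image s)
        (by rintro _ ⟨i, hi, rfl⟩; exact hB i hi) b
        (by rintro ⟨i, hi, h⟩; exact b_ne i hi h)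
      refine ⟨v, hvB, fun i hi => ?_⟩
      have hsi : s i ∈ s '' Set.Iio n := ⟨i, hi, rfl⟩
      have hne : s i ≠ v := fun h => hvA (h ▸ hsi)
      have hpne : p i ≠ p n := fun h => hi.ne (p.injective h)
      refine ⟨?_, ?_, hvr _ hsi⟩
      · rw [hne.le_iff_lt, hpne.le_iff_lt, (hv _ hsi).1, lt_b i hi]
      · rw [hne.symm.le_iff_lt, hpne.symm.le_iff_lt, (hv _ hsi).2, b_lt i hi])
  refine ⟨OrderEmbedding.ofMapLEIff (fun x => s (p.symm x)) fun x y => ?_, fun x => hsB _,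
    fun x y hxy => ?_⟩
  · obtain ⟨i, rfl⟩ := p.surjective x
    obtain ⟨j, rfl⟩ := p.surjective y
    simp only [Equiv.symm_apply_apply]
    rcases lt_trichotomy i j with hij | rfl | hij
    · exact (hs j i hij).1
    · simp
    · exact (hs i j hij).2.1
  · rcases lt_or_gt_of_ne (p.symm.injective.ne hxy) with h | h
    · exact .inl (hs _ _ h).2.2
    · exact .inr (hs _ _ h).2.2

variable [Countable P] [Infinite P]

/-- Local replicability: basic open sets contain copies of `P`. -/
theorem containsCopy_basicOpen (ultra : Ultrahomogeneous P) (age : FiniteUniversal P)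
    {A : Set P} (hA : A.Finite) {b : P} (hb : b ∉ A) : ContainsCopy (basicOpen A b) := by
  have : Countable (P ×ₗ P) := inferInstanceAs (Countable (P × P))
  have : Infinite (P ×ₗ P) := inferInstanceAs (Infinite (P × P))
  obtain ⟨h, -⟩ := exists_orderEmbedding_of_forall_realize ultra age (P ×ₗ P) Set.univ
    (fun _ _ => True) fun A _ _ b hb => ⟨b, ⟨hb, by simp⟩, by simp⟩
  have : Finite A := hA
  obtain ⟨g, hg⟩ := ultra.exists_orderIso_apply_eq (fun a : A => h (toLex (a, b)))
    (fun a => (a : P)) fun a a' => by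
      rw [h.le_iff_le, Prod.Lex.le_iff, le_iff_lt_or_eq (a := (a : P))]
      simp
  let f : P ↪o P := OrderEmbedding.ofMapLEIff (fun p => g (h (toLex (b, p)))) fun p q => by
    simp [Prod.Lex.le_iff]
  have hne {a : P} (ha : a ∈ A) : a ≠ b := fun h => hb (h ▸ ha)
  refine ⟨f, fun p => ⟨fun hp => ?_, fun a ha => ?_⟩⟩
  · have := h.injective (g.injective (hg ⟨_, hp⟩))
    exact hne hp (congrArg (fun z => (ofLex z).1) this)
  · have lhs : a = g (h (toLex (a, b))) := (hg ⟨a, ha⟩).symm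
    have rhs : f p = g (h (toLex (b, p))) := rfl
    constructor
    · conv_lhs => rw [lhs, rhs]
      simp [Prod.Lex.lt_iff, hne ha]
    · conv_lhs => rw [lhs, rhs]
      simp [Prod.Lex.lt_iff, (hne ha).symm]

/-- Indivisibility. -/
theorem ContainsCopy.of_union (ultra : Ultrahomogeneous P) (age : FiniteUniversal P)
    {B C : Set P} (h : ContainsCopy (B ∪ C)) : ContainsCopy B ∨ ContainsCopy C := by
  obtain ⟨f, hf⟩ := h
  by_cases H : ∀ A : Set P, A.Finite → A ⊆ f ⁻¹' B → ∀ b ∉ A,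
      ∃ v ∈ basicOpen A b, v ∈ f ⁻¹' B ∧ ∀ a ∈ A, True
  · obtain ⟨g, hg, -⟩ := exists_orderEmbedding_of_forall_realize ultra age P (f ⁻¹' B)
      (fun _ _ => True) H
    exact .inl ⟨g.trans f, hg⟩
  · push Not at H
    obtain ⟨A, hA, -, b, hb, H⟩ := H
    obtain ⟨g, hg⟩ := containsCopy_basicOpen ultra age hA hb
    refine .inr ⟨g.trans f, fun p => (hf (g p)).resolve_left fun hB => ?_⟩
    simpa using H (g p) (hg p) hB

theorem ContainsCopy.exists_of_biUnion (ultra : Ultrahomogeneous P) (age : FiniteUniversal P)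
    {ι : Type*} (T : Finset ι) (B : ι → Set P) (h : ContainsCopy (⋃ i ∈ T, B i)) :
    ∃ i ∈ T, ContainsCopy (B i) := by
  classical
  induction T using Finset.induction_on with
  | empty =>
    obtain ⟨f, hf⟩ := h
    simpa using hf (Classical.arbitrary P)
  | insert i T _ ih =>
    rw [Finset.set_biUnion_insert] at h
    rcases h.of_union ultra age with h | h
    · exact ⟨i, Finset.mem_insert_self _ _, h⟩
    · obtain ⟨j, hj, hB⟩ := ih h
      exact ⟨j, Finset.mem_insert_of_mem hj, hB⟩

/-- Any family of `k`-sets indexed by `P` is a sunflower on some copy of `P`. -/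
theorem exists_sunflower (ultra : Ultrahomogeneous P) (age : FiniteUniversal P)
    {α : Type x} (k : ℕ) (F : P → Finset α) (hF : ∀ p, (F p).card = k) :
    ∃ (f : P ↪o P) (c : Set α), ∀ p q, p ≠ q →
      (F (f p) : Set α) ∩ (F (f q) : Set α) = c := by
  classical
  induction k generalizing F with
  | zero =>
    refine ⟨RelEmbedding.refl _, ∅, fun p q _ => ?_⟩
    simp [Finset.card_eq_zero.mp (hF _)]
  | succ k ih =>
    by_cases H : ∃ z, ContainsCopy {p | z ∈ F p}
    · obtain ⟨z, g, hg⟩ := H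
      obtain ⟨f, c, hc⟩ := ih (fun p => (F (g p)).erase z) fun p => by
        rw [Finset.card_erase_of_mem (hg p), hF, Nat.add_sub_cancel]
      refine ⟨f.trans g, insert z c, fun p q hpq => ?_⟩
      have hp : F (g (f p)) = insert z ((F (g (f p))).erase z) :=
        (Finset.insert_erase (hg _)).symm
      have hq : F (g (f q)) = insert z ((F (g (f q))).erase z) :=
        (Finset.insert_erase (hg _)).symm
      change (F (g (f p)) : Set α) ∩ (F (g (f q)) : Set α) = _
      rw [hp, hq, Finset.coe_insert, Finset.coe_insert, ← Set.insert_inter_distrib, hc p q hpq]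
    · obtain ⟨f, -, hf⟩ := exists_orderEmbedding_of_forall_realize ultra age P Set.univ
        (fun p q => Disjoint (F p) (F q)) (by
          intro A hA _ b hb
          by_contra! hcon
          obtain ⟨g, hg⟩ := containsCopy_basicOpen ultra age hA hb
          obtain ⟨z, -, hz⟩ := ContainsCopy.exists_of_biUnion ultra age
            (hA.toFinset.biUnion F) (fun z => {p | z ∈ F p}) ⟨g, fun p => by
              obtain ⟨a, ha, had⟩ := hcon (g p) (hg p) (Set.mem_univ _)
              obtain ⟨z, hza, hzp⟩ := Finset.not_disjoint_iff.mp had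
              simp only [Set.mem_iUnion]
              exact ⟨z, Finset.mem_biUnion.mpr ⟨a, by simpa using ha, hza⟩, hzp⟩⟩
          exact H ⟨z, hz⟩)
      refine ⟨f, ∅, fun p q hpq => ?_⟩
      have : Disjoint (F (f p)) (F (f q)) := (hf p q hpq).elim id fun h => h.symm
      exact (Finset.disjoint_coe.mpr this).inter_eq

end

end GenericPoset

/-- The generic poset `P` is locally replicable (every basic open set contains an
order-isomorphic copy of `P`), and consequently `P` has the infinite sunflower
property. -/
theorem statement8 (P : Type u) [PartialOrder P] [Countable P] [Infinite P]
    (ultra : ∀ A B : Set P, A.Finite → B.Finite →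
      ∀ e : ↥A ≃o ↥B, ∃ g : P ≃o P, ∀ a : ↥A, g ↑a = ↑(e a))
    (age : ∀ (Q : Type u) [PartialOrder Q] [Fintype Q], Nonempty (Q ↪o P)) :
    (∀ A : Set P, A.Finite → ∀ b : P, b ∉ A →
      ∃ S : Set P,
        S ⊆ {v : P | v ∉ A ∧ ∀ a ∈ A, (a < v ↔ a < b) ∧ (v < a ↔ b < a)} ∧
        Nonempty (P ≃o ↥S)) ∧
    (∀ k : ℕ, 1 ≤ k → ∀ (α : Type x) (X : Set (Finset α)), (∀ v ∈ X, v.card = k) →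
      ∀ lt : ↥X → ↥X → Prop, Nonempty (((· < ·) : P → P → Prop) ≃r lt) →
        ∃ (f : ((· < ·) : P → P → Prop) ↪r lt) (c : Set α),
          ∀ p q : P, p ≠ q →
            ((f p : Finset α) : Set α) ∩ ((f q : Finset α) : Set α) = c) := by
  refine ⟨fun A hA b hb => ?_, fun k _ α X hX lt ⟨φ⟩ => ?_⟩
  · obtain ⟨f, hf⟩ := GenericPoset.containsCopy_basicOpen ultra age hA hb
    exact ⟨Set.range f, Set.range_subset_iff.mpr hf, ⟨f.orderIso⟩⟩
  · obtain ⟨f, c, hc⟩ := GenericPoset.exists_sunflower ultra age k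
      (fun p => (φ p : Finset α)) fun p => hX _ (φ p).2
    exact ⟨f.ltEmbedding.trans φ.toRelEmbedding, c, hc⟩
end

section
/- Let K be a Fraïssé class with the very canonical vertex-Ramsey property. Then K has the finite sunflower property. -/
open FirstOrder FirstOrder.Language Set CategoryTheory

universe u v w x

section ClassDefs

variable (L : FirstOrder.Language.{u, v})

/-- The finite `k`-sunflower property for a class `K`: for every `B ∈ K` there is `C ∈ K`
such that every structure on `k`-sets isomorphic to `C` contains an induced substructure
isomorphic to `B` whose domain is a sunflower. -/
def FiniteKSunflowerProperty (K : Set (Bundled.{w} L.Structure)) (k : ℕ) : Prop :=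
  ∀ B ∈ K, ∃ C ∈ K,
    ∀ (α : Type x) (X : Set (Finset α)), (∀ v ∈ X, v.card = k) →
      ∀ [L.Structure ↥X], Nonempty (C ≃[L] ↥X) →
        ∃ (f : B ↪[L] ↥X) (c : Set α),
          ∀ a b : B, a ≠ b →
            ((f a : Finset α) : Set α) ∩ ((f b : Finset α) : Set α) = c

/-- The very canonical vertex-Ramsey property for a class `K`. -/
def VeryCanonicalVertexRamsey (K : Set (Bundled.{w} L.Structure)) : Prop :=
  ∀ s : ℕ, 1 ≤ s → ∀ B ∈ K, ∃ C ∈ K, ∃ π : C → Fin (Nat.card B),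
    ∀ χ : Fin s → C → ℕ,
      (∃ (r : Fin s) (i : Fin (Nat.card B)) (e : B ↪[L] C),
        (∀ x : B, π (e x) = i) ∧ ∀ x y : B, χ r (e x) = χ r (e y)) ∨
      (∃ e : B ↪[L] C, Function.Bijective (fun x : B => π (e x)) ∧
        ∀ r : Fin s, Function.Injective (fun x : B => χ r (e x)))

end ClassDefs

section Helpers

variable {L : FirstOrder.Language.{u, v}} {K : Set (Bundled.{w} L.Structure)}

/-- The very canonical vertex-Ramsey property forces every member of the class to be finite. -/
theorem VeryCanonicalVertexRamsey.finite (hVC : VeryCanonicalVertexRamsey L K)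
    {B : Bundled.{w} L.Structure} (hB : B ∈ K) : Finite B := by
  by_contra hfin
  rw [not_finite_iff_infinite] at hfin
  obtain ⟨C, -, π, h⟩ := hVC 1 le_rfl B hB
  have hcard : Nat.card B = 0 := Nat.card_eq_zero_of_infinite
  obtain ⟨b⟩ : Nonempty B := inferInstance
  have hπ : C → False := fun c => by
    have := (π c).isLt
    omega
  rcases h fun _ _ => 0 with ⟨-, -, e, -⟩ | ⟨e, -⟩ <;> exact hπ (e b)

/-- A strengthening of the finite `k`-sunflower property, in which the points of
`C` are labelled by `k`-sets, not necessarily injectively. -/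
theorem VeryCanonicalVertexRamsey.exists_sunflower_labelling
    (hVC : VeryCanonicalVertexRamsey L K) (k : ℕ) :
    ∀ B ∈ K, ∃ C ∈ K, Nonempty (B ↪[L] C) ∧
      ∀ (α : Type x) (F : C → Finset α), (∀ v, (F v).card = k) →
        ∃ (e : B ↪[L] C) (c : Set α), ∀ a b : B, a ≠ b →
          (F (e a) : Set α) ∩ (F (e b) : Set α) = c := by
  classical
  induction k with
  | zero =>
    intro B hB
    refine ⟨B, hB, ⟨Embedding.refl L B⟩, fun α F hF => ⟨Embedding.refl L B, ∅, fun a b _ => ?_⟩⟩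
    simp [Finset.card_eq_zero.mp (hF _)]
  | succ k ih =>
    intro B hB
    obtain ⟨D, hD, ⟨ι⟩, hsun⟩ := ih B hB
    let T := Fin (Nat.card D) → Fin (k + 1)
    obtain ⟨C, hC, π, hπ⟩ := hVC (Fintype.card T) Fintype.card_pos D hD
    have := hVC.finite hC
    refine ⟨C, hC, ?_, fun α F hF => ?_⟩
    · rcases hπ fun _ _ => 0 with ⟨-, -, e, -⟩ | ⟨e, -⟩ <;> exact ⟨e.comp ι⟩
    let el (c : C) (j : Fin (k + 1)) : α := ((F c).equivFinOfCardEq (hF c)).symm j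
    have el_mem (c : C) (j : Fin (k + 1)) : el c j ∈ F c := Subtype.property _
    have exists_el {c : C} {a : α} (ha : a ∈ F c) : ∃ j, el c j = a :=
      ⟨(F c).equivFinOfCardEq (hF c) ⟨a, ha⟩, by simp [el]⟩
    obtain ⟨g, hg⟩ := Set.countable_iff_exists_injOn.mp
      (Set.finite_iUnion fun c : C => (F c).finite_toSet).countable
    have el_eq {c d : C} {i j : Fin (k + 1)} (h : g (el c i) = g (el d j)) : el c i = el d j :=
      hg (Set.mem_iUnion.mpr ⟨c, el_mem c i⟩) (Set.mem_iUnion.mpr ⟨d, el_mem d j⟩) h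
    let E := Fintype.equivFin T
    rcases hπ fun r c => g (el c (E.symm r (π c))) with ⟨r, i, e, hei, hmono⟩ | ⟨e, hbij, hinj⟩
    · have : Nonempty D := (Nat.card_pos_iff.mp i.pos).1
      obtain ⟨d⟩ := this
      have hmem (y : D) : el (e d) (E.symm r i) ∈ F (e y) := by
        have h := el_eq (hmono d y)
        simp only [hei] at h
        exact h ▸ el_mem _ _
      set a := el (e d) (E.symm r i)
      obtain ⟨f, c, hf⟩ := hsun α (fun y => (F (e y)).erase a) fun y => by
        simp [Finset.card_erase_of_mem (hmem y), hF]
      refine ⟨e.comp f, insert a c, fun p q hpq => ?_⟩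
      rw [← hf p q hpq, Embedding.comp_apply, Embedding.comp_apply, Finset.coe_erase,
        Finset.coe_erase, Set.insert_inter_distrib, Set.insert_sdiff_singleton,
        Set.insert_sdiff_singleton, Set.insert_eq_of_mem (Finset.mem_coe.mpr (hmem _)),
        Set.insert_eq_of_mem (Finset.mem_coe.mpr (hmem _))]
    · refine ⟨e.comp ι, ∅, fun p q hpq => Set.eq_empty_of_forall_notMem fun a ⟨hap, haq⟩ => ?_⟩
      obtain ⟨i, hi⟩ := exists_el hap
      obtain ⟨j, hj⟩ := exists_el haq
      have hne : ι p ≠ ι q := ι.injective.ne hpq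
      have hπne : π (e (ι q)) ≠ π (e (ι p)) := fun h => hne (hbij.injective h.symm)
      refine hne (hinj (E fun m => if m = π (e (ι p)) then i else j) ?_)
      simp only [Equiv.symm_apply_apply, if_true, if_neg hπne]
      exact congrArg g (hi.trans hj.symm)

end Helpers

/-- A Fraïssé class with the very canonical vertex-Ramsey property has the finite
sunflower property. -/
theorem statement13 (L : FirstOrder.Language.{u, v}) (K : Set (Bundled.{w} L.Structure))
    (hK : IsFraisse K) (hVC : VeryCanonicalVertexRamsey L K) :
    ∀ k : ℕ, 1 ≤ k → FiniteKSunflowerProperty.{u, v, w, x} L K k := by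
  intro k _ B hB
  obtain ⟨C, hC, -, h⟩ := hVC.exists_sunflower_labelling k B hB
  refine ⟨C, hC, fun α X hX _ ⟨φ⟩ => ?_⟩
  obtain ⟨e, c, hc⟩ := h α (fun v => (φ v : Finset α)) fun v => hX _ (φ v).2
  exact ⟨φ.toEmbedding.comp e, c, hc⟩
end

section
/- Let n, s, g be natural numbers with n ≥ 2, g ≥ 2 and s ≥ 1. Then there exists a finite n-uniform hypergraph H with girth ≥ g together with a partition V₀, …, V_{n−1} of its vertex set such that for any s vertex-colourings χ₀, …, χ_{s−1} of H with values in ℕ, at least one of the following holds: (a) there exist r < s, i < n and an edge e of H with e ⊆ V_i such that χ_r is constant on e; (b) there exists an edge e of H meeting each V_i in exactly one point such that χ_r is injective on e for every r < s. -/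
/-- An `m`-cycle in the hypergraph with edge set `E`: distinct vertices `v 0, …, v (m-1)`
and distinct edges `e 0, …, e (m-1)` with `{v i, v (i+1 mod m)} ⊆ e i` for all `i`. -/
def HasCycle {V : Type*} (E : Finset (Finset V)) (m : ℕ) : Prop :=
  ∃ (v : Fin m → V) (e : Fin m → Finset V),
    Function.Injective v ∧ Function.Injective e ∧ (∀ i, e i ∈ E) ∧
    ∀ i : Fin m, v i ∈ e i ∧
      v ⟨(i.1 + 1) % m, Nat.mod_lt _ (Nat.lt_of_le_of_lt (Nat.zero_le _) i.2)⟩ ∈ e i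

section

open Finset

/-- The part in which the `j`-th vertex of an edge of the given type lies: edges of type `some i`
lie inside the part `i`, edges of type `none` are transversal. -/
def edgePart {n : ℕ} (τ : Option (Fin n)) (j : Fin n) : Fin n := τ.getD j

/-- The edge of type `τ` whose `j`-th vertex has position `x j` within its part. -/
def typedEdge {n N : ℕ} (τ : Option (Fin n)) (x : Fin n → Fin N) : Finset (Fin (n * N)) :=
  univ.image fun j => finProdFinEquiv (edgePart τ j, x j)

theorem card_typedEdge_le {n N : ℕ} (τ : Option (Fin n)) (x : Fin n → Fin N) :
    #(typedEdge τ x) ≤ n := by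
  simpa only [typedEdge, card_univ, Fintype.card_fin] using card_image_le
    (s := univ) (f := fun j => finProdFinEquiv (edgePart τ j, x j))

/-- The edges of a cycle of length `m` in a hypergraph with edges of size at most `n` cover at most
`(n - 1) * m` vertices. -/
theorem card_biUnion_le_of_cycle {V : Type*} [DecidableEq V] {n m : ℕ} (hm : 2 ≤ m)
    {v : Fin m → V} {e : Fin m → Finset V} (hv : Function.Injective v) (hcard : ∀ i, #(e i) ≤ n)
    (hve : ∀ i : Fin m, v i ∈ e i ∧
      v ⟨(i.1 + 1) % m, Nat.mod_lt _ (Nat.lt_of_le_of_lt (Nat.zero_le _) i.2)⟩ ∈ e i) :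
    #(univ.biUnion e) ≤ (n - 1) * m := by
  set nxt : Fin m → Fin m := fun i =>
    ⟨(i.1 + 1) % m, Nat.mod_lt _ (Nat.lt_of_le_of_lt (Nat.zero_le _) i.2)⟩ with hnxt
  have hne : ∀ i, nxt i ≠ i := by
    intro i h
    have h1 : (i.1 + 1) % m = i.1 := congrArg Fin.val h
    have := i.2
    rcases Nat.lt_or_ge (i.1 + 1) m with h2 | h2
    · rw [Nat.mod_eq_of_lt h2] at h1; omega
    · have h3 : i.1 + 1 = m := by omega
      rw [h3, Nat.mod_self] at h1; omega
  have hsub : univ.biUnion e ⊆ univ.biUnion fun i => (e i).erase (v (nxt i)) := by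
    intro x hx
    simp only [mem_biUnion, mem_univ, true_and, mem_erase] at hx ⊢
    obtain ⟨i, hi⟩ := hx
    by_cases hxi : x = v (nxt i)
    · refine ⟨nxt i, ?_, hxi ▸ (hve (nxt i)).1⟩
      rw [hxi]
      exact fun h => hne _ (hv h).symm
    · exact ⟨i, hxi, hi⟩
  calc #(univ.biUnion e) ≤ _ := card_le_card hsub
    _ ≤ #(univ : Finset (Fin m)) * (n - 1) := by
        refine card_biUnion_le_card_mul _ _ _ fun i _ => ?_
        rw [card_erase_of_mem (hve i).2]
        exact Nat.sub_le_sub_right (hcard i) 1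
    _ = (n - 1) * m := by simp [mul_comm]

/-- There is a threshold colour at which a set with small colour classes splits into two
substantial pieces. -/
theorem exists_threshold {α : Type*} (U : Finset α) (χ : α → ℕ) (d : ℕ)
    (hd : ∀ c, #{x ∈ U | χ x = c} ≤ d) (hU : 3 * d ≤ #U) :
    ∃ t, #U ≤ 3 * #{x ∈ U | χ x < t} ∧ #U ≤ 3 * #{x ∈ U | t ≤ χ x} := by
  classical
  have hex : ∃ t, #U ≤ 3 * #{x ∈ U | χ x < t} := by
    refine ⟨U.sup χ + 1, ?_⟩
    rw [filter_true_of_mem fun x hx => Nat.lt_succ_of_le (le_sup hx)]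
    omega
  refine ⟨Nat.find hex, Nat.find_spec hex, ?_⟩
  have hsplit : ∀ t, #{x ∈ U | χ x < t} + #{x ∈ U | t ≤ χ x} = #U := fun t => by
    simpa using card_filter_add_card_filter_not (s := U) (fun x => χ x < t)
  rcases ht : Nat.find hex with _ | t
  · have := hsplit 0
    simp only [not_lt_zero, filter_false, card_empty] at this
    omega
  · have hlt := Nat.find_min hex (m := t) (by omega)
    have hle : #{x ∈ U | χ x < t + 1} ≤ #{x ∈ U | χ x < t} + #{x ∈ U | χ x = t} := by
      refine (card_le_card ?_).trans (card_union_le _ _)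
      intro x hx
      simp only [mem_filter, mem_union] at hx ⊢
      have := hx.1
      rcases Nat.lt_succ_iff_lt_or_eq.1 hx.2 with h | h <;> tauto
    have := hd t
    have := hsplit (t + 1)
    omega

/-- Two coloured sets with small colour classes have substantial subsets sharing no colour. -/
theorem exists_subsets_disjoint_colours {α β : Type*} (U : Finset α) (U' : Finset β)
    (χ : α → ℕ) (χ' : β → ℕ) (d : ℕ)
    (hd : ∀ c, #{x ∈ U | χ x = c} ≤ d) (hd' : ∀ c, #{x ∈ U' | χ' x = c} ≤ d)
    (hU : 3 * d ≤ #U) (hU' : 3 * d ≤ #U') :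
    ∃ A ⊆ U, ∃ A' ⊆ U', #U ≤ 3 * #A ∧ #U' ≤ 3 * #A' ∧ ∀ x ∈ A, ∀ y ∈ A', χ x ≠ χ' y := by
  obtain ⟨t, h1, h2⟩ := exists_threshold U χ d hd hU
  obtain ⟨t', h1', h2'⟩ := exists_threshold U' χ' d hd' hU'
  rcases le_total t t' with h | h
  · refine ⟨_, filter_subset _ _, _, filter_subset _ _, h1, h2', fun x hx y hy => ?_⟩
    have := (mem_filter.1 hx).2
    have := (mem_filter.1 hy).2
    omega
  · refine ⟨_, filter_subset _ _, _, filter_subset _ _, h2, h1', fun x hx y hy => ?_⟩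
    have := (mem_filter.1 hx).2
    have := (mem_filter.1 hy).2
    omega

/-- If all colour classes are small, then each part has a substantial subset so that the colours
appearing on the subsets of different parts are distinct, for the prescribed colourings and pairs
of parts. -/
theorem exists_separated_subsets {ρ ι α : Type*} [DecidableEq ρ] [DecidableEq ι] [Fintype α]
    (χ : ρ → ι → α → ℕ) (d k : ℕ) (hd : ∀ r i c, #{x | χ r i x = c} ≤ d)
    (hN : 3 ^ (k + 1) * d ≤ Fintype.card α) (T : Finset (ρ × ι × ι)) (hT : #T ≤ k) :
    ∃ U : ι → Finset α, (∀ i, Fintype.card α ≤ 3 ^ #T * #(U i)) ∧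
      ∀ r i j, (r, i, j) ∈ T → i ≠ j → ∀ x ∈ U i, ∀ y ∈ U j, χ r i x ≠ χ r j y := by
  classical
  induction T using Finset.induction_on with
  | empty => exact ⟨fun _ => univ, by simp, by simp⟩
  | insert a T ha ih =>
    obtain ⟨r, i, j⟩ := a
    rw [card_insert_of_notMem ha] at hT ⊢
    obtain ⟨U, hU, hsep⟩ := ih (by omega)
    by_cases hij : i = j
    · refine ⟨U, fun l => (hU l).trans ?_, ?_⟩
      · exact Nat.mul_le_mul_right _ (Nat.pow_le_pow_right (by norm_num) (by omega))
      · intro r' i' j' h hne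
        rcases mem_insert.1 h with h | h
        · simp only [Prod.mk.injEq] at h
          exact absurd (h.2.1.trans (hij.trans h.2.2.symm)) hne
        · exact hsep r' i' j' h hne
    · have hbig : ∀ l, 3 * d ≤ #(U l) := fun l => by
        have h1 : 3 ^ #T * (3 * d) ≤ 3 ^ #T * #(U l) := by
          refine le_trans ?_ (hN.trans (hU l))
          rw [← mul_assoc, ← pow_succ]
          exact Nat.mul_le_mul_right _ (Nat.pow_le_pow_right (by norm_num) (by omega))
        exact Nat.le_of_mul_le_mul_left h1 (by positivity)
      have hsmall : ∀ l c, #{x ∈ U l | χ r l x = c} ≤ d := fun l c =>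
        (card_le_card (filter_subset_filter _ (subset_univ _))).trans (hd r l c)
      obtain ⟨A, hA, A', hA', hcA, hcA', hAA'⟩ := exists_subsets_disjoint_colours (U i) (U j)
        (χ r i) (χ r j) d (hsmall i) (hsmall j) (hbig i) (hbig j)
      set W : ι → Finset α := Function.update (Function.update U i A) j A' with hW
      have hWi : W i = A := by simp [hW, hij]
      have hWj : W j = A' := by simp [hW]
      have hWsub : ∀ l, W l ⊆ U l ∧ #(U l) ≤ 3 * #(W l) := fun l => by
        by_cases hj : l = j
        · subst hj; rw [hWj]; exact ⟨hA', hcA'⟩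
        · by_cases hi : l = i
          · subst hi; rw [hWi]; exact ⟨hA, hcA⟩
          · simp only [hW, Function.update_of_ne hj, Function.update_of_ne hi]
            exact ⟨subset_rfl, by omega⟩
      refine ⟨W, fun l => (hU l).trans ?_, ?_⟩
      · rw [pow_succ, mul_assoc]
        exact Nat.mul_le_mul_left _ (hWsub l).2
      · intro r' i' j' h hne x hx y hy
        rcases mem_insert.1 h with h | h
        · simp only [Prod.mk.injEq] at h
          obtain ⟨rfl, rfl, rfl⟩ := h
          exact hAA' x (hWi ▸ hx) y (hWj ▸ hy)
        · exact hsep r' i' j' h hne x ((hWsub _).1 hx) y ((hWsub _).1 hy)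

/-- Few families of edges are such that the edges indexed by `J` cover at most `(n - 1) * #J`
vertices. -/
theorem card_badFamilies_le {ι : Type*} [Fintype ι] [DecidableEq ι] {n N g : ℕ} (hn : 1 ≤ n)
    (hN : 1 ≤ N) (τ : ι → Option (Fin n)) (J : Finset ι) (hJ : #J < g) :
    (#{ω : ι → Fin n → Fin N | #(J.biUnion fun i => typedEdge (τ i) (ω i)) ≤ (n - 1) * #J} : ℝ) ≤
      ((N : ℝ) ^ n) ^ Fintype.card ι * ((n ^ n * (n * g) ^ n : ℕ) / N : ℝ) ^ #J := by
  set t := #J with ht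
  set q := (n - 1) * t with hq
  have hV : Nonempty (Fin (n * N)) := ⟨⟨0, by positivity⟩⟩
  let S : (Fin q → Fin (n * N)) → ι → Fin n → Finset (Fin N) := fun w i j =>
    {x | finProdFinEquiv (edgePart (τ i) j, x) ∈ univ.image w}
  let Q : (Fin q → Fin (n * N)) → Finset (ι → Fin n → Fin N) := fun w =>
    Fintype.piFinset fun i => if i ∈ J then Fintype.piFinset (S w i) else univ
  have hS : ∀ w i j, #(S w i j) ≤ q := fun w i j => by
    have h1 : #(univ.image w) ≤ q := by simpa using card_image_le (s := univ) (f := w)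
    refine le_trans (card_le_card_of_injOn
      (fun x => finProdFinEquiv (edgePart (τ i) j, x)) ?_ ?_) h1
    · intro x hx
      simpa [S] using hx
    · intro x _ y _ hxy
      simpa using hxy
  have hQ : ∀ w, #(Q w) ≤ (q ^ n) ^ t * (N ^ n) ^ (Fintype.card ι - t) := fun w => by
    rw [Fintype.card_piFinset]
    calc ∏ i, #(if i ∈ J then Fintype.piFinset (S w i) else univ)
        ≤ ∏ i, (if i ∈ J then q ^ n else N ^ n) := by
          refine prod_le_prod' fun i _ => ?_
          split_ifs
          · rw [Fintype.card_piFinset]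
            simpa using prod_le_pow_card (univ : Finset (Fin n)) (fun j => #(S w i j)) q
              fun j _ => hS w i j
          · simp
      _ = _ := by
          rw [prod_ite, prod_const, prod_const, filter_mem_eq_inter, univ_inter,
            filter_not, filter_mem_eq_inter, univ_inter, ← compl_eq_univ_sdiff, card_compl]
  have hcover : ({ω : ι → Fin n → Fin N |
      #(J.biUnion fun i => typedEdge (τ i) (ω i)) ≤ (n - 1) * t} : Finset _) ⊆
      univ.biUnion Q := by
    intro ω hω
    have hω' : #(J.biUnion fun i => typedEdge (τ i) (ω i)) ≤ q := (mem_filter.1 hω).2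
    set B := J.biUnion fun i => typedEdge (τ i) (ω i) with hB
    obtain ⟨w, hw⟩ : ∃ w : Fin q → Fin (n * N), B ⊆ univ.image w := by
      refine ⟨fun k => if h : k.1 < #B then (B.equivFin.symm ⟨k.1, h⟩).1 else Classical.arbitrary _,
        fun b hb => ?_⟩
      have hlt := (B.equivFin ⟨b, hb⟩).2
      exact mem_image.2 ⟨⟨(B.equivFin ⟨b, hb⟩).1, by omega⟩, mem_univ _, by simp⟩
    refine mem_biUnion.2 ⟨w, mem_univ _, Fintype.mem_piFinset.2 fun i => ?_⟩
    split_ifs with hi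
    · refine Fintype.mem_piFinset.2 fun j => mem_filter.2 ⟨mem_univ _, hw ?_⟩
      exact mem_biUnion.2 ⟨i, hi, mem_image.2 ⟨j, mem_univ _, rfl⟩⟩
    · exact mem_univ _
  have htle : t ≤ Fintype.card ι := card_le_univ J
  have hcount := (card_le_card hcover).trans (card_biUnion_le_card_mul univ Q _ fun w _ => hQ w)
  simp only [card_univ, Fintype.card_fun, Fintype.card_fin] at hcount
  have hqg : q ≤ n * g := Nat.mul_le_mul (Nat.sub_le _ _) hJ.le
  have hqn : q + t = n * t := by
    obtain ⟨k, rfl⟩ : ∃ k, n = k + 1 := ⟨n - 1, by omega⟩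
    simp only [hq, Nat.add_sub_cancel]; ring
  have hnat : (n * N) ^ q * ((q ^ n) ^ t * (N ^ n) ^ (Fintype.card ι - t)) * N ^ t ≤
      (N ^ n) ^ Fintype.card ι * (n ^ n * (n * g) ^ n) ^ t := by
    calc (n * N) ^ q * ((q ^ n) ^ t * (N ^ n) ^ (Fintype.card ι - t)) * N ^ t
        = n ^ q * (q ^ n) ^ t * (N ^ (q + t) * (N ^ n) ^ (Fintype.card ι - t)) := by
          rw [mul_pow, pow_add]; ring
      _ = n ^ q * (q ^ n) ^ t * (N ^ n) ^ Fintype.card ι := by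
          rw [hqn, pow_mul N n t, ← pow_add, Nat.add_sub_cancel' htle]
      _ ≤ (n ^ n) ^ t * ((n * g) ^ n) ^ t * (N ^ n) ^ Fintype.card ι := by
          rw [← pow_mul n n t]
          gcongr
          omega
      _ = _ := by rw [mul_pow]; ring
  have hN0 : (0 : ℝ) < N := by exact_mod_cast hN
  rw [div_pow, ← mul_div_assoc, le_div_iff₀ (by positivity)]
  exact_mod_cast (Nat.mul_le_mul_right _ hcount).trans hnat

/-- Exponential moment bound for the number of edges of type `τ` with all vertices in the
prescribed sets. -/
theorem sum_half_pow_hits_le {n M N d R : ℕ} (hN : N = R * d) (hd : 1 ≤ d) (hR : 1 ≤ R)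
    (τ : Option (Fin n)) (U : Fin n → Finset (Fin N)) (hU : ∀ j, d ≤ #(U j)) :
    ∑ ω : Option (Fin n) × Fin M → Fin n → Fin N,
        (1 / 2 : ℝ) ^ #{k | ∀ j, ω (τ, k) j ∈ U j} ≤
      ((N : ℝ) ^ n) ^ Fintype.card (Option (Fin n) × Fin M) *
        (1 - 1 / (2 * (R : ℝ) ^ n)) ^ M := by
  have hd0 : (0 : ℝ) < d := by exact_mod_cast hd
  have hR0 : (0 : ℝ) < R := by exact_mod_cast hR
  let f : Option (Fin n) → (Fin n → Fin N) → ℝ := fun σ x =>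
    if σ = τ then (if ∀ j, x j ∈ U j then 1 / 2 else 1) else 1
  have hf : ∀ ω : Option (Fin n) × Fin M → Fin n → Fin N,
      (1 / 2 : ℝ) ^ #{k | ∀ j, ω (τ, k) j ∈ U j} = ∏ i, f i.1 (ω i) := fun ω => by
    rw [Fintype.prod_prod_type, Fintype.prod_eq_single τ]
    · simp only [f, if_true]
      rw [prod_ite, prod_const, prod_const_one, mul_one]
    · intro σ hσ
      simp [f, hσ]
  have hτ : ∑ x, f τ x ≤ (N : ℝ) ^ n * (1 - 1 / (2 * (R : ℝ) ^ n)) := by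
    have h1 : ∀ x, f τ x = 1 - 1 / 2 * (if x ∈ Fintype.piFinset U then (1 : ℝ) else 0) := by
      intro x
      simp only [f, if_true, Fintype.mem_piFinset]
      split_ifs <;> norm_num
    have h2 : (d : ℝ) ^ n ≤ #(Fintype.piFinset U) := by
      rw [Fintype.card_piFinset]
      have : ∏ _j : Fin n, d ≤ ∏ j, #(U j) := prod_le_prod' fun j _ => hU j
      simp only [prod_const, card_univ, Fintype.card_fin] at this
      exact_mod_cast this
    have h3 : (N : ℝ) ^ n * (1 - 1 / (2 * (R : ℝ) ^ n)) = (N : ℝ) ^ n - (d : ℝ) ^ n / 2 := by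
      rw [hN]; push_cast; rw [mul_pow]; field_simp
    simp only [h1, sum_sub_distrib, ← mul_sum, sum_boole, filter_mem_eq_inter, univ_inter]
    rw [h3]
    simp only [sum_const, card_univ, Fintype.card_fun, Fintype.card_fin, nsmul_eq_mul, mul_one]
    push_cast
    linarith
  have hother : ∀ σ, σ ≠ τ → ∑ x, f σ x = (N : ℝ) ^ n := fun σ hσ => by
    simp [f, hσ]
  have hpos : 0 ≤ ∑ x, f τ x := sum_nonneg fun x _ => by
    simp only [f]; split_ifs <;> norm_num
  calc ∑ ω : Option (Fin n) × Fin M → Fin n → Fin N, (1 / 2 : ℝ) ^ #{k | ∀ j, ω (τ, k) j ∈ U j}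
      = ∏ i : Option (Fin n) × Fin M, ∑ x, f i.1 x := by
        simp only [hf, prod_univ_sum, Fintype.piFinset_univ]
    _ = (∏ σ, ∑ x, f σ x) ^ M := by
        rw [Fintype.prod_prod_type]
        simp [prod_pow]
    _ ≤ (((N : ℝ) ^ n) ^ (n + 1) * (1 - 1 / (2 * (R : ℝ) ^ n))) ^ M := by
        have hprod : ∏ σ, ∑ x, f σ x = (∑ x, f τ x) * ((N : ℝ) ^ n) ^ n := by
          rw [← mul_prod_erase univ _ (mem_univ τ),
            prod_congr rfl fun σ hσ => hother σ (ne_of_mem_erase hσ)]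
          simp
        rw [hprod]
        refine pow_le_pow_left₀ (by positivity) ?_ _
        calc (∑ x, f τ x) * ((N : ℝ) ^ n) ^ n
            ≤ ((N : ℝ) ^ n * (1 - 1 / (2 * (R : ℝ) ^ n))) * ((N : ℝ) ^ n) ^ n := by gcongr
          _ = _ := by ring
    _ = _ := by
        rw [mul_pow, ← pow_mul ((N : ℝ) ^ n)]
        simp

/-- There is a finite family of edges of all types in which every small subfamily covers many
vertices, and every product of sets of size at least `d` contains an edge of each type. -/
theorem exists_sparse_dense_family (n g R : ℕ) (hn : 1 ≤ n) (hR : 1 ≤ R) :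
    ∃ d M N : ℕ, N = R * d ∧ ∃ (ω : Option (Fin n) × Fin M → Fin n → Fin N)
      (I : Finset (Option (Fin n) × Fin M)),
      (∀ J ⊆ I, J.Nonempty → #J < g → (n - 1) * #J < #(J.biUnion fun i => typedEdge i.1 (ω i))) ∧
      ∀ (τ : Option (Fin n)) (U : Fin n → Finset (Fin N)), (∀ j, d ≤ #(U j)) →
        ∃ k, (τ, k) ∈ I ∧ ∀ j, ω (τ, k) j ∈ U j := by
  have hR1 : (1 : ℝ) ≤ (R : ℝ) ^ n := one_le_pow₀ (by exact_mod_cast hR)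
  set ε : ℝ := 1 / (2 * (R : ℝ) ^ n) with hε
  have hε0 : 0 < ε := by positivity
  have hε1 : ε ≤ 1 := by
    rw [hε, div_le_one (by positivity)]; linarith
  obtain ⟨C, hC⟩ : ∃ C : ℕ, (1 - ε) ^ C < (1 / 2 : ℝ) ^ (n + 1) :=
    exists_pow_lt_of_lt_one (by positivity) (by linarith)
  set A : ℕ := n ^ n * (n * g) ^ n with hA
  obtain ⟨K, hK⟩ := exists_nat_ge (Real.exp (A * ((n + 1) * C)))
  have hK0 : (0 : ℝ) < K := (Real.exp_pos _).trans_le hK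
  set B : ℕ := 2 * K with hB
  set d : ℕ := (n + 1) * 2 ^ (B + 1) with hd
  have hd1 : 1 ≤ d := Nat.succ_le_of_lt (by positivity)
  set N : ℕ := R * d with hN
  have hdN : d ≤ N := Nat.le_mul_of_pos_left d hR
  have hN0 : (0 : ℝ) < N := by exact_mod_cast hd1.trans hdN
  set M : ℕ := C * N with hM
  set Ω : ℝ := ((N : ℝ) ^ n) ^ Fintype.card (Option (Fin n) × Fin M) with hΩ
  have hΩ0 : 0 < Ω := by positivity
  have hΩcard : (Fintype.card (Option (Fin n) × Fin M → Fin n → Fin N) : ℝ) = Ω := by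
    simp [hΩ]
  let bad : (Option (Fin n) × Fin M → Fin n → Fin N) →
      Finset (Finset (Option (Fin n) × Fin M)) := fun ω =>
    {J | (J.Nonempty ∧ #J < g) ∧ #(J.biUnion fun i => typedEdge i.1 (ω i)) ≤ (n - 1) * #J}
  let large : Finset (Option (Fin n) × (Fin n → Finset (Fin N))) := {p | ∀ j, d ≤ #(p.2 j)}
  let hits : (Option (Fin n) × Fin M → Fin n → Fin N) →
      Option (Fin n) × (Fin n → Finset (Fin N)) → ℕ := fun ω p => #{k | ∀ j, ω (p.1, k) j ∈ p.2 j}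
  have hbad : ∑ ω, (#(bad ω) : ℝ) ≤ Ω * K := by
    have hJ : ∀ J : Finset (Option (Fin n) × Fin M),
        ∑ ω, (if J ∈ bad ω then (1 : ℝ) else 0) ≤ Ω * (A / N : ℝ) ^ #J := fun J => by
      by_cases h : J.Nonempty ∧ #J < g
      · have := card_badFamilies_le (N := N) hn (hd1.trans hdN) (fun i => i.1) J h.2
        simpa [bad, h, hΩ, hA] using this
      · simp only [bad, mem_filter, h, false_and, and_false, if_false, sum_const_zero]
        positivity
    calc ∑ ω, (#(bad ω) : ℝ) = ∑ J, ∑ ω, (if J ∈ bad ω then (1 : ℝ) else 0) := by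
          rw [sum_comm]
          simp
      _ ≤ ∑ J : Finset (Option (Fin n) × Fin M), Ω * (A / N : ℝ) ^ #J := sum_le_sum fun J _ => hJ J
      _ = Ω * (A / N + 1 : ℝ) ^ ((n + 1) * M) := by
          rw [← mul_sum]
          congr 1
          have := Fintype.sum_pow_mul_eq_add_pow (Option (Fin n) × Fin M) (A / N : ℝ) 1
          simpa using this
      _ ≤ Ω * Real.exp (A / N) ^ ((n + 1) * M) := by
          gcongr
          exact Real.add_one_le_exp _
      _ = Ω * Real.exp (A * ((n + 1) * C)) := by
          rw [← Real.exp_nat_mul, hM]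
          congr 2
          push_cast
          field_simp
      _ ≤ Ω * K := by gcongr
  have hhits : ∑ ω, ∑ p ∈ large, 2 ^ B * (1 / 2 : ℝ) ^ hits ω p < Ω / 2 := by
    have hcard : (#large : ℝ) ≤ (n + 1) * (2 ^ N) ^ n := by
      have := card_le_univ large
      simp only [Fintype.card_prod, Fintype.card_option, Fintype.card_fin, Fintype.card_fun,
        Fintype.card_finset] at this
      exact_mod_cast this
    have hpow : (1 - ε) ^ M ≤ ((1 / 2 : ℝ) ^ (n + 1)) ^ N := by
      rw [hM, pow_mul]
      exact pow_le_pow_left₀ (pow_nonneg (by linarith) _) hC.le _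
    have hlt : ((n + 1) * 2 ^ (B + 1) : ℝ) < 2 ^ N := by
      have : d < 2 ^ N := hdN.trans_lt Nat.lt_two_pow_self
      exact_mod_cast this
    calc ∑ ω, ∑ p ∈ large, 2 ^ B * (1 / 2 : ℝ) ^ hits ω p
        = ∑ p ∈ large, 2 ^ B * ∑ ω, (1 / 2 : ℝ) ^ hits ω p := by
          rw [sum_comm]
          simp only [mul_sum]
      _ ≤ ∑ p ∈ large, 2 ^ B * (Ω * (1 - ε) ^ M) := by
          refine sum_le_sum fun p hp => ?_
          gcongr
          exact sum_half_pow_hits_le hN hd1 hR p.1 p.2 (mem_filter.1 hp).2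
      _ = #large * (2 ^ B * (Ω * (1 - ε) ^ M)) := by rw [sum_const, nsmul_eq_mul]
      _ ≤ ((n + 1) * (2 ^ N) ^ n) * (2 ^ B * (Ω * ((1 / 2 : ℝ) ^ (n + 1)) ^ N)) := by gcongr
      _ = ((n + 1) * 2 ^ (B + 1)) * (Ω / 2 * (1 / 2 ^ N)) := by
          have h1 : ((1 / 2 : ℝ) ^ (n + 1)) ^ N = 1 / ((2 ^ N) ^ n * 2 ^ N) := by
            rw [← pow_mul, one_div_pow, ← pow_succ, ← pow_mul, mul_comm N]
          rw [h1]
          field_simp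
          ring
      _ < 2 ^ N * (Ω / 2 * (1 / 2 ^ N)) := by gcongr
      _ = Ω / 2 := by field_simp
  obtain ⟨ω, -, hω⟩ : ∃ ω ∈ (univ : Finset (Option (Fin n) × Fin M → Fin n → Fin N)),
      (#(bad ω) : ℝ) / B + ∑ p ∈ large, 2 ^ B * (1 / 2 : ℝ) ^ hits ω p < 1 := by
    refine exists_lt_of_sum_lt ?_
    rw [sum_add_distrib, ← sum_div, sum_const, card_univ, nsmul_eq_mul, hΩcard, mul_one]
    have : (∑ ω, (#(bad ω) : ℝ)) / B ≤ Ω / 2 := by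
      rw [hB]
      push_cast
      rw [div_le_div_iff₀ (by positivity) (by norm_num)]
      linarith
    linarith
  have hsum0 : 0 ≤ ∑ p ∈ large, 2 ^ B * (1 / 2 : ℝ) ^ hits ω p :=
    sum_nonneg fun _ _ => by positivity
  have hbadlt : #(bad ω) < B := by
    have hB0 : (0 : ℝ) < B := by rw [hB]; push_cast; positivity
    have h : (#(bad ω) : ℝ) / B < 1 := by linarith
    rw [div_lt_one hB0] at h
    exact_mod_cast h
  have hhitslt : ∀ p ∈ large, B < hits ω p := fun p hp => by
    have h1 : 2 ^ B * (1 / 2 : ℝ) ^ hits ω p < 1 := by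
      have h2 := single_le_sum (f := fun p => 2 ^ B * (1 / 2 : ℝ) ^ hits ω p)
        (fun _ _ => by positivity) hp
      have h3 : 0 ≤ (#(bad ω) : ℝ) / B := by positivity
      linarith
    rw [one_div_pow, mul_one_div, div_lt_one (by positivity)] at h1
    exact (pow_lt_pow_iff_right₀ (by norm_num)).1 h1
  have hchoice : ∀ J : Finset (Option (Fin n) × Fin M), ∃ i, J ∈ bad ω → i ∈ J := fun J => by
    by_cases h : J ∈ bad ω
    · obtain ⟨i, hi⟩ := (mem_filter.1 h).2.1.1
      exact ⟨i, fun _ => hi⟩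
    · have hp : (none, fun _ => univ) ∈ large := by simp [large, hdN]
      have h0 := (Nat.zero_le _).trans_lt (hhitslt _ hp)
      obtain ⟨k, -⟩ := card_pos.1 h0
      exact ⟨(none, k), fun h' => absurd h' h⟩
  choose c hc using hchoice
  refine ⟨d, M, N, hN, ω, univ \ (bad ω).image c, ?_, ?_⟩
  · intro J hJ hJne hJg
    by_contra hcon
    have hJbad : J ∈ bad ω := mem_filter.2 ⟨mem_univ _, ⟨hJne, hJg⟩, not_lt.1 hcon⟩
    exact (mem_sdiff.1 (hJ (hc J hJbad))).2 (mem_image_of_mem c hJbad)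
  · intro τ U hU
    have hlt : #((bad ω).image c) < #(({k | ∀ j, ω (τ, k) j ∈ U j} : Finset (Fin M)).image
        fun k => (τ, k)) := by
      rw [card_image_of_injective _ (Prod.mk_right_injective τ)]
      exact card_image_le.trans_lt
        (hbadlt.trans (hhitslt (τ, U) (mem_filter.2 ⟨mem_univ _, hU⟩)))
    obtain ⟨i, hi, hi'⟩ := exists_mem_notMem_of_card_lt_card hlt
    obtain ⟨k, hk, rfl⟩ := mem_image.1 hi
    exact ⟨k, mem_sdiff.2 ⟨mem_univ _, hi'⟩, (mem_filter.1 hk).2⟩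

end

/-- A canonical vertex-Ramsey theorem for hypergraphs of large girth: for `n, g ≥ 2` and
`s ≥ 1` there is a finite `n`-uniform hypergraph of girth `≥ g` with an `n`-part vertex
partition `π` such that, for any `s` vertex-colourings, either some colouring is constant
on some edge lying inside one part, or some transversal edge is heterochromatic in all
the colourings. -/
theorem statement14 (n s g : ℕ) (hn : 2 ≤ n) (hg : 2 ≤ g) (hs : 1 ≤ s) :
    ∃ (m : ℕ) (E : Finset (Finset (Fin m))) (π : Fin m → Fin n),
      (∀ e ∈ E, e.card = n) ∧
      (∀ m' : ℕ, 2 ≤ m' → m' < g → ¬ HasCycle E m') ∧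
      ∀ χ : Fin s → Fin m → ℕ,
        (∃ (r : Fin s) (i : Fin n), ∃ e ∈ E,
          (∀ x ∈ e, π x = i) ∧ ∀ x ∈ e, ∀ y ∈ e, χ r x = χ r y) ∨
        (∃ e ∈ E, (∀ i : Fin n, ∃! x, x ∈ e ∧ π x = i) ∧
          ∀ r : Fin s, Set.InjOn (χ r) ↑e) := by
  classical
  obtain ⟨d, M, N, hN, ω, I, hsparse, hdense⟩ :=
    exists_sparse_dense_family n g (3 ^ (s * (n * n) + 1)) (by omega) (Nat.one_le_pow _ _ (by omega))
  set edge : Option (Fin n) × Fin M → Finset (Fin (n * N)) := fun i => typedEdge i.1 (ω i)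
    with hedge
  have hmem : ∀ i x, x ∈ edge i ↔ ∃ j, finProdFinEquiv (edgePart i.1 j, ω i j) = x := by
    simp [hedge, typedEdge]
  refine ⟨n * N, I.image edge, fun x => (finProdFinEquiv.symm x).1, ?_, ?_, ?_⟩
  · intro e he
    obtain ⟨i, hi, rfl⟩ := Finset.mem_image.1 he
    have h1 := hsparse {i} (by simpa using hi) (by simp) (by simp; omega)
    simp only [Finset.card_singleton, Finset.singleton_biUnion, mul_one] at h1
    have h2 : (edge i).card ≤ n := card_typedEdge_le _ _
    change (edge i).card = n
    change n - 1 < (edge i).card at h1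
    omega
  · rintro m hm hmg ⟨v, e, hv, he, heE, hve⟩
    choose idx hidx hidxe using fun i => Finset.mem_image.1 (heE i)
    have hinj : Function.Injective idx := fun i j hij => he (by rw [← hidxe i, ← hidxe j, hij])
    have hcard : (Finset.univ.image idx).card = m := by
      simp [Finset.card_image_of_injective _ hinj]
    have h1 := hsparse (Finset.univ.image idx) (by
      intro i hi
      obtain ⟨j, -, rfl⟩ := Finset.mem_image.1 hi
      exact hidx j) (Finset.card_pos.1 (by omega)) (by omega)
    have h2 := card_biUnion_le_of_cycle (n := n) hm hv
      (fun i => hidxe i ▸ card_typedEdge_le _ _) hve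
    rw [Finset.image_biUnion, hcard] at h1
    have h3 : (fun i => typedEdge (idx i).1 (ω (idx i))) = e := funext hidxe
    rw [h3] at h1
    omega
  · intro χ
    by_cases ha : ∃ (r : Fin s) (i : Fin n), ∃ e ∈ I.image edge,
        (∀ x ∈ e, (finProdFinEquiv.symm x).1 = i) ∧ ∀ x ∈ e, ∀ y ∈ e, χ r x = χ r y
    · exact Or.inl ha
    right
    have hsmall : ∀ (r : Fin s) (i : Fin n) (c : ℕ),
        (Finset.univ.filter fun x : Fin N => χ r (finProdFinEquiv (i, x)) = c).card ≤ d := by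
      intro r i c
      by_contra! hcon
      obtain ⟨k, hk, hkU⟩ := hdense (some i) (fun _ => Finset.univ.filter
        fun x : Fin N => χ r (finProdFinEquiv (i, x)) = c) (fun _ => hcon.le)
      have hc : ∀ x ∈ edge (some i, k), χ r x = c := by
        intro x hx
        obtain ⟨j, rfl⟩ := (hmem _ _).1 hx
        exact (Finset.mem_filter.1 (hkU j)).2
      refine ha ⟨r, i, edge (some i, k), Finset.mem_image_of_mem _ hk, ?_, ?_⟩
      · intro x hx
        obtain ⟨j, rfl⟩ := (hmem _ _).1 hx
        simp [edgePart]
      · intro x hx y hy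
        rw [hc x hx, hc y hy]
    obtain ⟨U, hU, hsep⟩ := exists_separated_subsets
      (fun r i (x : Fin N) => χ r (finProdFinEquiv (i, x))) d (s * (n * n)) hsmall
      (by simp [hN]) Finset.univ (by simp)
    have hUd : ∀ j, d ≤ (U j).card := fun j => by
      have h1 := hU j
      simp only [Fintype.card_fin, Finset.card_univ, Fintype.card_prod] at h1
      replace h1 := hN.symm.le.trans h1
      rw [pow_succ, mul_assoc] at h1
      have := Nat.le_of_mul_le_mul_left h1 (by positivity)
      omega
    obtain ⟨k, hk, hkU⟩ := hdense none U hUd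
    refine ⟨edge (none, k), Finset.mem_image_of_mem _ hk, ?_, ?_⟩
    · intro i
      refine ⟨finProdFinEquiv (i, ω (none, k) i), ⟨(hmem _ _).2 ⟨i, rfl⟩, by simp⟩, ?_⟩
      rintro y ⟨hy, hyi⟩
      obtain ⟨j, rfl⟩ := (hmem _ _).1 hy
      simp only [edgePart, Option.getD_none, Equiv.symm_apply_apply] at hyi
      subst hyi
      rfl
    · intro r x hx y hy hxy
      obtain ⟨i, rfl⟩ := (hmem _ _).1 hx
      obtain ⟨j, rfl⟩ := (hmem _ _).1 hy
      by_cases hij : i = j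
      · rw [hij]
      · exact absurd hxy (hsep r i j (Finset.mem_univ _) hij _ (hkU i) _ (hkU j))
end

section
/- Let L be a countable relational language and let K be a transitive free amalgamation class of finite L-structures. Then K has the very canonical vertex-Ramsey property, and hence K has the finite sunflower property. -/
open FirstOrder FirstOrder.Language Set CategoryTheory

universe u v w x

section FreeAmalg

variable (L : FirstOrder.Language.{u, v})

/-- A class has free amalgamation if any two embeddings from a common structure have a
strong amalgam in which every related tuple lies entirely in the image of one of the two
structures. -/
def HasFreeAmalgamation (K : Set (Bundled.{w} L.Structure)) : Prop :=
  ∀ A B₀ B₁ : Bundled.{w} L.Structure, A ∈ K → B₀ ∈ K → B₁ ∈ K →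
    ∀ (f₀ : A ↪[L] B₀) (f₁ : A ↪[L] B₁),
      ∃ C : Bundled.{w} L.Structure, C ∈ K ∧
        ∃ (g₀ : B₀ ↪[L] C) (g₁ : B₁ ↪[L] C),
          g₀.comp f₀ = g₁.comp f₁ ∧
          Set.range g₀ ∩ Set.range g₁ = Set.range (g₀.comp f₀) ∧
          ∀ (n : ℕ) (R : L.Relations n) (t : Fin n → C), Structure.RelMap R t →
            (∀ i, t i ∈ Set.range g₀) ∨ (∀ i, t i ∈ Set.range g₁)

/-- A class is transitive if all vertices of all structures in the class realize the same
quantifier-free type. -/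
def TransitiveClass (K : Set (Bundled.{w} L.Structure)) : Prop :=
  ∀ A ∈ K, ∀ B ∈ K, ∀ (a : A) (b : B) (φ : L.Formula (Fin 1)), φ.IsQF →
    (φ.Realize (fun _ => a) ↔ φ.Realize (fun _ => b))

end FreeAmalg

section Gluing

variable {L : FirstOrder.Language.{u, v}}

/-- The structure on `A` pulled back from a structure on `V` along a map, for a relational
language. -/
abbrev pullbackStructure [L.IsRelational] {A V : Type*} [L.Structure V] (f : A → V) :
    L.Structure A where
  RelMap R t := Structure.RelMap R (f ∘ t)
  funMap F := isEmptyElim F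

/-- In a relational language, an injective map that preserves and reflects relations is an
embedding. -/
def embeddingOfRelMapIff [L.IsRelational] {A V : Type*} [L.Structure A] [L.Structure V]
    (f : A → V) (hf : Function.Injective f)
    (hrel : ∀ (n : ℕ) (R : L.Relations n) (t : Fin n → A),
      Structure.RelMap R (f ∘ t) ↔ Structure.RelMap R t) : A ↪[L] V where
  toFun := f
  inj' := hf
  map_fun' F := isEmptyElim F
  map_rel' R t := hrel _ R t

/-- A set of vertices is independent if it only carries constant related tuples. -/
def IndepSet (L : FirstOrder.Language.{u, v}) {A : Type*} [L.Structure A] (S : Set A) : Prop :=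
  ∀ (n : ℕ) (R : L.Relations n) (t : Fin n → A), (∀ k, t k ∈ S) → Structure.RelMap R t →
    ∀ k l, t k = t l

variable {K : Set (Bundled.{w} L.Structure)}

theorem TransitiveClass.relMap_const_iff (htrans : TransitiveClass L K)
    {A B : Bundled.{w} L.Structure} (hA : A ∈ K) (hB : B ∈ K) (a : A) (b : B) {n : ℕ}
    (R : L.Relations n) :
    Structure.RelMap R (fun _ => a) ↔ Structure.RelMap R (fun _ => b) := by
  have h := htrans A hA B hB a b (R.formula fun _ => Term.var 0)
    (BoundedFormula.IsAtomic.rel _ _).isQF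
  simpa [Formula.realize_rel] using h

/-- Tuples with the same equality pattern in independent sets satisfy the same relations. -/
theorem TransitiveClass.relMap_of_indepSet (htrans : TransitiveClass L K)
    {A B : Bundled.{w} L.Structure} (hA : A ∈ K) (hB : B ∈ K) [Nonempty A] [Nonempty B]
    {S : Set A} (hS : IndepSet L S) {n : ℕ} (R : L.Relations n) (s : Fin n → A)
    (t : Fin n → B) (hs : ∀ k, s k ∈ S) (hst : ∀ k l, s k = s l → t k = t l)
    (h : Structure.RelMap R s) : Structure.RelMap R t := by
  have hc := hS n R s hs h
  obtain ⟨a, ha⟩ : ∃ a, s = fun _ => a := by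
    cases n with
    | zero => exact ⟨Classical.arbitrary A, funext fun k => k.elim0⟩
    | succ n => exact ⟨s 0, funext fun k => hc k 0⟩
  obtain ⟨b, hb⟩ : ∃ b, t = fun _ => b := by
    cases n with
    | zero => exact ⟨Classical.arbitrary B, funext fun k => k.elim0⟩
    | succ n => exact ⟨t 0, funext fun k => hst k 0 (hc k 0)⟩
  rw [hb, ← htrans.relMap_const_iff hA hB a b, ← ha]
  exact h

variable [L.IsRelational]

theorem FirstOrder.Language.IsFraisse.finite (hK : IsFraisse K)
    {A : Bundled.{w} L.Structure} (hA : A ∈ K) : Finite A :=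
  (hK.FG A hA).finite

theorem FirstOrder.Language.IsFraisse.mem_of_embedding (hK : IsFraisse K)
    {A B : Bundled.{w} L.Structure} (hB : B ∈ K) (f : A ↪[L] B) : A ∈ K := by
  have := hK.finite hB
  have : Finite A := Finite.of_injective f f.injective
  exact hK.hereditary B hB ⟨Structure.FG.of_finite, ⟨f⟩⟩

/-- Let `u` and `v` be distinct vertices that lie in no common related tuple. If deleting either
of them gives a member of a free amalgamation class, then the structure is in the class. -/
theorem HasFreeAmalgamation.mem_of_compl_singleton_mem (hK : IsFraisse K)
    (hfree : HasFreeAmalgamation L K) {A : Type w} [G : L.Structure A] {u v : A} (huv : u ≠ v)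
    (hrel : ∀ (n : ℕ) (R : L.Relations n) (t : Fin n → A), Structure.RelMap R t →
      (∀ k, t k ≠ u) ∨ (∀ k, t k ≠ v))
    (hu : (⟨{x // x ≠ u}, pullbackStructure Subtype.val⟩ : Bundled.{w} L.Structure) ∈ K)
    (hv : (⟨{x // x ≠ v}, pullbackStructure Subtype.val⟩ : Bundled.{w} L.Structure) ∈ K) :
    (⟨A, G⟩ : Bundled.{w} L.Structure) ∈ K := by
  classical
  let (p : A → Prop) : L.Structure {x // p x} := pullbackStructure Subtype.val
  let f₀ : {x // x ≠ u ∧ x ≠ v} ↪[L] {x // x ≠ u} :=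
    embeddingOfRelMapIff (fun x => ⟨x.1, x.2.1⟩)
      (fun x y h => by simpa [Subtype.ext_iff] using h) (fun n R t => Iff.rfl)
  let f₁ : {x // x ≠ u ∧ x ≠ v} ↪[L] {x // x ≠ v} :=
    embeddingOfRelMapIff (fun x => ⟨x.1, x.2.2⟩)
      (fun x y h => by simpa [Subtype.ext_iff] using h) (fun n R t => Iff.rfl)
  obtain ⟨C, hC, g₀, g₁, hcomm, hinter, hCrel⟩ :=
    hfree ⟨{x // x ≠ u ∧ x ≠ v}, inferInstance⟩ _ _ (hK.mem_of_embedding hu f₀) hu hv f₀ f₁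
  have hagree : ∀ (x : A) (h₀ : x ≠ u) (h₁ : x ≠ v), g₀ ⟨x, h₀⟩ = g₁ ⟨x, h₁⟩ := fun x h₀ h₁ =>
    congrArg (fun g : {x // x ≠ u ∧ x ≠ v} ↪[L] C => g ⟨x, h₀, h₁⟩) hcomm
  let h : A → C := fun x => if hx : x ≠ u then g₀ ⟨x, hx⟩ else
    g₁ ⟨x, fun hxv => huv ((not_not.1 hx).symm.trans hxv)⟩
  have h₀ : ∀ x (hx : x ≠ u), h x = g₀ ⟨x, hx⟩ := fun x hx => dif_pos hx
  have h₁ : ∀ x (hx : x ≠ v), h x = g₁ ⟨x, hx⟩ := by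
    intro x hx
    by_cases hxu : x ≠ u
    · rw [h₀ x hxu, hagree x hxu hx]
    · exact dif_neg hxu
  have hsep : ∀ (x y : A) (hx : x ≠ u) (hy : y ≠ v), g₀ ⟨x, hx⟩ = g₁ ⟨y, hy⟩ →
      x ≠ v ∧ y ≠ u := by
    intro x y hx hy hxy
    have hmem : g₀ ⟨x, hx⟩ ∈ range g₀ ∩ range g₁ := ⟨⟨_, rfl⟩, ⟨_, hxy.symm⟩⟩
    rw [hinter] at hmem
    obtain ⟨z, hz⟩ := hmem
    have hzx : f₀ z = ⟨x, hx⟩ := g₀.injective hz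
    have hzy : f₁ z = ⟨y, hy⟩ := by
      apply g₁.injective
      rw [← hxy, ← hz, hcomm]
      rfl
    have e₀ : z.1 = x := congrArg Subtype.val hzx
    have e₁ : z.1 = y := congrArg Subtype.val hzy
    exact ⟨e₀ ▸ z.2.2, e₁ ▸ z.2.1⟩
  have hinj : Function.Injective h := by
    intro x y hxy
    by_cases hx : x ≠ u
    · by_cases hy : y ≠ u
      · rw [h₀ x hx, h₀ y hy] at hxy
        exact congrArg Subtype.val (g₀.injective hxy)
      · have hy' : y ≠ v := fun hyv => huv ((not_not.1 hy).symm.trans hyv)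
        rw [h₀ x hx, h₁ y hy'] at hxy
        exact absurd (hsep x y hx hy' hxy).2 hy
    · have hx' : x ≠ v := fun hxv => huv ((not_not.1 hx).symm.trans hxv)
      by_cases hy : y ≠ u
      · rw [h₁ x hx', h₀ y hy] at hxy
        exact absurd (hsep y x hy hx' hxy.symm).2 hx
      · exact (not_not.1 hx).trans (not_not.1 hy).symm
  have hrel₀ : ∀ (n : ℕ) (R : L.Relations n) (t : Fin n → A), (∀ k, t k ≠ u) →
      (Structure.RelMap R (h ∘ t) ↔ Structure.RelMap R t) := by
    intro n R t ht
    have e : h ∘ t = g₀ ∘ fun k => (⟨t k, ht k⟩ : {x // x ≠ u}) := funext fun k => h₀ _ (ht k)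
    rw [e]
    exact g₀.map_rel R _
  have hrel₁ : ∀ (n : ℕ) (R : L.Relations n) (t : Fin n → A), (∀ k, t k ≠ v) →
      (Structure.RelMap R (h ∘ t) ↔ Structure.RelMap R t) := by
    intro n R t ht
    have e : h ∘ t = g₁ ∘ fun k => (⟨t k, ht k⟩ : {x // x ≠ v}) := funext fun k => h₁ _ (ht k)
    rw [e]
    exact g₁.map_rel R _
  refine hK.mem_of_embedding (A := ⟨A, G⟩) hC (embeddingOfRelMapIff h hinj fun n R t => ⟨?_, ?_⟩)
  · intro hR
    rcases hCrel n R _ hR with hr | hr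
    · refine (hrel₀ n R t fun k hk => ?_).1 hR
      obtain ⟨⟨x, hx⟩, hxk⟩ := hr k
      have hkv : t k ≠ v := hk ▸ huv
      rw [Function.comp_apply, h₁ _ hkv] at hxk
      exact (hsep x _ hx hkv hxk).2 hk
    · refine (hrel₁ n R t fun k hk => ?_).1 hR
      obtain ⟨⟨x, hx⟩, hxk⟩ := hr k
      have hku : t k ≠ u := hk ▸ huv.symm
      rw [Function.comp_apply, h₀ _ hku] at hxk
      exact (hsep _ x hku hx hxk.symm).1 hk
  · intro hR
    rcases hrel n R t hR with hr | hr
    · exact (hrel₀ n R t hr).2 hR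
    · exact (hrel₁ n R t hr).2 hR

/-- Members of a free amalgamation class can be glued along a compatible system of maps
such that every set of vertices that is pairwise covered is covered. -/
theorem HasFreeAmalgamation.exists_glued (hK : IsFraisse K) (hfree : HasFreeAmalgamation L K)
    {V : Type w} [Finite V] {ι : Type*} (E : ι → Bundled.{w} L.Structure) (hE : ∀ i, E i ∈ K)
    (f : ∀ i, E i → V) (hcover : ∀ v, ∃ i, v ∈ range (f i))
    (hcompat : ∀ (i j : ι) (n : ℕ) (R : L.Relations n) (s : Fin n → E i) (t : Fin n → E j),
      (∀ k, f i (s k) = f j (t k)) → Structure.RelMap R s → Structure.RelMap R t)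
    (hclique : ∀ S : Set V, (∀ u ∈ S, ∀ v ∈ S, ∃ i, u ∈ range (f i) ∧ v ∈ range (f i)) →
      ∃ i, S ⊆ range (f i)) :
    ∃ G : L.Structure V, (⟨V, G⟩ : Bundled.{w} L.Structure) ∈ K ∧
      (∀ (i : ι) (n : ℕ) (R : L.Relations n) (s : Fin n → E i),
        Structure.RelMap R (f i ∘ s) ↔ Structure.RelMap R s) ∧
      ∀ (n : ℕ) (R : L.Relations n) (t : Fin n → V), Structure.RelMap R t →
        ∃ (i : ι) (s : Fin n → E i), t = f i ∘ s := by
  let G : L.Structure V :=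
    { RelMap := fun R t => ∃ (i : ι) (s : Fin _ → E i), t = f i ∘ s ∧ Structure.RelMap R s
      funMap := fun F => isEmptyElim F }
  have hrel : ∀ (i : ι) (n : ℕ) (R : L.Relations n) (s : Fin n → E i),
      Structure.RelMap R (f i ∘ s) ↔ Structure.RelMap R s := fun i n R s =>
    ⟨fun ⟨j, t, hst, h⟩ => hcompat j i n R t s (fun k => (congrFun hst k).symm) h,
      fun h => ⟨i, s, rfl, h⟩⟩
  have hind : ∀ (m : ℕ) (A : Type w) (g : A → V), Function.Injective g → Nat.card A = m →
      (⟨A, pullbackStructure g⟩ : Bundled.{w} L.Structure) ∈ K := by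
    intro m
    induction m using Nat.strong_induction_on with
    | _ m ih =>
    intro A g hg hm
    have : Finite A := Finite.of_injective g hg
    by_cases hc : ∀ u ∈ range g, ∀ v ∈ range g, ∃ i, u ∈ range (f i) ∧ v ∈ range (f i)
    · obtain ⟨i, hi⟩ := hclique _ hc
      choose p hp using fun a => hi ⟨a, rfl⟩
      have hfp : f i ∘ p = g := funext hp
      refine hK.mem_of_embedding (A := ⟨A, pullbackStructure g⟩) (hE i)
        (@embeddingOfRelMapIff L _ A (E i) (pullbackStructure g) _ p ?_ ?_)
      · exact fun a b hab => hg (by rw [← hp a, ← hp b, hab])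
      · intro n R t
        rw [← hrel i n R (p ∘ t), ← Function.comp_assoc, hfp]
        rfl
    · push Not at hc
      obtain ⟨_, ⟨a, rfl⟩, _, ⟨b, rfl⟩, hab⟩ := hc
      have hne : ∀ a : A, (⟨{x // x ≠ a}, pullbackStructure (g ∘ Subtype.val)⟩ :
          Bundled.{w} L.Structure) ∈ K := fun a =>
        ih _ (hm ▸ Finite.card_subtype_lt (x := a) (by simp)) _ _
          (hg.comp Subtype.val_injective) rfl
      have hb : a ≠ b := by
        rintro rfl
        obtain ⟨i, hi⟩ := hcover (g a)
        exact hab i hi hi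
      refine @HasFreeAmalgamation.mem_of_compl_singleton_mem L K _ hK hfree A
        (pullbackStructure g) a b hb ?_ (hne a) (hne b)
      rintro n R t ⟨i, s, hst, -⟩
      by_contra! hcon
      obtain ⟨⟨k, hk⟩, l, hl⟩ := hcon
      exact hab i ⟨s k, by rw [← hk]; exact (congrFun hst k).symm⟩
        ⟨s l, by rw [← hl]; exact (congrFun hst l).symm⟩
  refine ⟨G, ?_, hrel, fun n R t ⟨i, s, hst, _⟩ => ⟨i, s, hst⟩⟩
  exact hind _ V id Function.injective_id rfl

/-- Disjoint copies of a structure without related tuples across copies. -/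
theorem HasFreeAmalgamation.exists_disjoint_copies (hK : IsFraisse K)
    (hfree : HasFreeAmalgamation L K) {E : Bundled.{w} L.Structure} (hE : E ∈ K)
    (N : Type w) [Finite N] [Nonempty N] :
    ∃ G : L.Structure (N × E), (⟨N × E, G⟩ : Bundled.{w} L.Structure) ∈ K ∧
      (∀ (c : N) (n : ℕ) (R : L.Relations n) (s : Fin n → E),
        Structure.RelMap R (Prod.mk c ∘ s) ↔ Structure.RelMap R s) ∧
      ∀ (n : ℕ) (R : L.Relations n) (t : Fin n → N × E), Structure.RelMap R t →
        ∃ (c : N) (s : Fin n → E), t = Prod.mk c ∘ s := by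
  have := hK.finite hE
  refine hfree.exists_glued hK (V := N × E) (fun _ : N => E) (fun _ => hE) Prod.mk ?_ ?_ ?_
  · exact fun v => ⟨v.1, v.2, rfl⟩
  · intro i j n R s t hst
    have : s = t := funext fun k => (Prod.ext_iff.1 (hst k)).2
    exact fun h => this ▸ h
  · intro S hS
    rcases S.eq_empty_or_nonempty with rfl | ⟨u, hu⟩
    · exact ⟨Classical.arbitrary N, empty_subset _⟩
    · refine ⟨u.1, fun v hv => ⟨v.2, ?_⟩⟩
      obtain ⟨i, ⟨x, rfl⟩, ⟨y, rfl⟩⟩ := hS u hu v hv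
      rfl

/-- The partite step: one independent part of `P` is replaced by `D`, with a copy of `P`
attached along every independent copy of that part in `D`. -/
theorem HasFreeAmalgamation.exists_partite_step (hK : IsFraisse K)
    (hfree : HasFreeAmalgamation L K) (htrans : TransitiveClass L K) {A : Type*}
    {P D : Bundled.{w} L.Structure} (hP : P ∈ K) (hD : D ∈ K) [Nonempty P] [Nonempty D]
    (π : P → A) (i : A) (hi : IndepSet L (π ⁻¹' {i})) :
    ∃ C ∈ K, ∃ (π' : C → A) (δ : D ↪[L] C), (∀ x, π' (δ x) = i) ∧
      (∀ a, a ≠ i → IndepSet L (π ⁻¹' {a}) → IndepSet L (π' ⁻¹' {a})) ∧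
      ∀ j : {p // π p = i} → D, Function.Injective j → IndepSet L (range j) →
        ∃ ε : P ↪[L] C, (∀ p, π' (ε p) = π p) ∧ ∀ p : {p // π p = i}, ε p = δ (j p) := by
  classical
  have := hK.finite hP
  have := hK.finite hD
  let J := {j : {p // π p = i} → D // Function.Injective j ∧ IndepSet L (range j)}
  let V := D ⊕ (J × {p // π p ≠ i})
  let attach : J → P → V := fun j p =>
    if h : π p = i then Sum.inl (j.1 ⟨p, h⟩) else Sum.inr (j, ⟨p, h⟩)
  have attach_inl : ∀ (j : J) (p : P) (h : π p = i), attach j p = Sum.inl (j.1 ⟨p, h⟩) :=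
    fun j p h => dif_pos h
  have attach_inr : ∀ (j : J) (p : P) (h : π p ≠ i), attach j p = Sum.inr (j, ⟨p, h⟩) :=
    fun j p h => dif_neg h
  have of_attach_inl : ∀ (j : J) (p : P) (d : D), attach j p = Sum.inl d →
      ∃ h : π p = i, j.1 ⟨p, h⟩ = d := by
    intro j p d hd
    by_cases h : π p = i
    · exact ⟨h, Sum.inl_injective ((attach_inl j p h).symm.trans hd)⟩
    · simp [attach_inr j p h] at hd
  have of_attach_inr : ∀ (j : J) (p : P) (q : J × {p // π p ≠ i}), attach j p = Sum.inr q →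
      j = q.1 ∧ p = q.2 := by
    intro j p q hq
    by_cases h : π p = i
    · simp [attach_inl j p h] at hq
    · rw [attach_inr j p h, Sum.inr.injEq] at hq
      subst hq
      exact ⟨rfl, rfl⟩
  have attach_injective : ∀ j, Function.Injective (attach j) := by
    intro j p q hpq
    by_cases h : π q = i
    · rw [attach_inl j q h] at hpq
      obtain ⟨h', e⟩ := of_attach_inl j p _ hpq
      exact congrArg Subtype.val (j.2.1 e)
    · rw [attach_inr j q h] at hpq
      exact (of_attach_inr j p _ hpq).2
  have attach_overlap : ∀ (j j' : J) (p q : P), j ≠ j' → attach j p = attach j' q →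
      ∃ (hp : π p = i) (hq : π q = i), j.1 ⟨p, hp⟩ = j'.1 ⟨q, hq⟩ := by
    intro j j' p q hj hpq
    by_cases h : π q = i
    · rw [attach_inl j' q h] at hpq
      obtain ⟨h', e⟩ := of_attach_inl j p _ hpq
      exact ⟨h', h, e⟩
    · rw [attach_inr j' q h] at hpq
      exact absurd (of_attach_inr j p _ hpq).1 hj
  let E : Option J → Bundled.{w} L.Structure := fun o => o.elim D fun _ => P
  let f : ∀ o, E o → V := fun o => match o with
    | none => Sum.inl
    | some j => attach j
  obtain ⟨G, hG, hrel, hcov⟩ := hfree.exists_glued hK (V := V) E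
    (fun o => by cases o; exacts [hD, hP]) f
    (by
      rintro (d | ⟨j, p, hp⟩)
      · exact ⟨none, d, rfl⟩
      · exact ⟨some j, p, attach_inr j p hp⟩)
    (by
      rintro (_ | j) (_ | j') n R s t hst
      · have : s = t := funext fun k => Sum.inl_injective (hst k)
        exact fun h => this ▸ h
      · choose h e using fun k => of_attach_inl j' (t k) (s k) (hst k).symm
        refine htrans.relMap_of_indepSet hD hP j'.2.2 R s t (fun k => ⟨_, e k⟩) fun k l hkl => ?_
        rw [← e k, ← e l] at hkl
        exact congrArg Subtype.val (j'.2.1 hkl)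
      · choose h e using fun k => of_attach_inl j (s k) (t k) (hst k)
        refine htrans.relMap_of_indepSet hP hD hi R s t h fun k l hkl => ?_
        rw [← e k, ← e l]
        exact congrArg j.1 (Subtype.ext hkl)
      · by_cases hj : j = j'
        · subst hj
          have : s = t := funext fun k => attach_injective j (hst k)
          exact fun h => this ▸ h
        · choose h h' e using fun k => attach_overlap j j' (s k) (t k) hj (hst k)
          refine htrans.relMap_of_indepSet hP hP hi R s t h fun k l hkl => ?_
          refine congrArg Subtype.val (j'.2.1 (a₁ := ⟨t k, h' k⟩) (a₂ := ⟨t l, h' l⟩) ?_)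
          rw [← e k, ← e l]
          exact congrArg j.1 (Subtype.ext hkl))
    (by
      intro S hS
      by_cases h : ∃ q, Sum.inr q ∈ S
      · obtain ⟨q, hq⟩ := h
        refine ⟨some q.1, fun v hv => ?_⟩
        obtain ⟨o, ⟨x, hx⟩, hv'⟩ := hS _ hq v hv
        cases o with
        | none => cases hx
        | some j => exact (of_attach_inr j x q hx).1 ▸ hv'
      · refine ⟨none, fun v hv => ?_⟩
        cases v with
        | inl d => exact ⟨d, rfl⟩
        | inr q => exact absurd ⟨q, hv⟩ h)
  let π' : V → A := Sum.elim (fun _ => i) fun q => π q.2.1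
  have hπ' : ∀ (j : J) (p : P), π' (attach j p) = π p := by
    intro j p
    by_cases h : π p = i
    · rw [attach_inl j p h]
      exact h.symm
    · rw [attach_inr j p h]
      rfl
  refine ⟨⟨V, G⟩, hG, π', embeddingOfRelMapIff Sum.inl Sum.inl_injective (hrel none),
    fun x => rfl, ?_, fun j hj hj' =>
      ⟨embeddingOfRelMapIff (attach ⟨j, hj, hj'⟩) (attach_injective _) (hrel (some ⟨j, hj, hj'⟩)),
        hπ' _, fun p => attach_inl _ _ p.2⟩⟩
  intro a ha hind n R t ht hR k l
  obtain ⟨o, s, rfl⟩ := hcov n R t hR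
  cases o with
  | none => exact absurd (ht k).symm ha
  | some j =>
    exact congrArg (attach j) (hind n R s (fun k => (hπ' j (s k)).symm.trans (ht k))
      ((hrel (some j) n R s).1 hR) k l)

/-- The partite construction: if every finite independent set can be found well-behaved in some
member of the class unless there is a bad copy of `B`, then the parts of a multipartite
structure can be made simultaneously well-behaved. The behaviour is measured by data that can
be pulled back along maps. -/
theorem HasFreeAmalgamation.exists_partite (hK : IsFraisse K) (hfree : HasFreeAmalgamation L K)
    (htrans : TransitiveClass L K) {A : Type*} [Finite A] {B : Bundled.{w} L.Structure}
    (Dat : Type w → Type*) (pull : ∀ {X Y : Type w}, (X → Y) → Dat Y → Dat X)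
    (Good : ∀ {X : Type w}, Dat X → X → X → Prop)
    (Bad : ∀ C : Bundled.{w} L.Structure, Dat C → (B ↪[L] C) → Prop)
    (hgood : ∀ {X Y : Type w} (f : X → Y) (d : Dat Y) (x y : X),
      Good (pull f d) x y → Good d (f x) (f y))
    (hbad : ∀ (C D : Bundled.{w} L.Structure) (ε : C ↪[L] D) (d : Dat D) (e : B ↪[L] C),
      Bad C (pull ε d) e → Bad D d (ε.comp e))
    (hD : ∀ (F : Type w) [Finite F], ∃ D ∈ K, Nonempty D ∧ ∀ d : Dat D, (∃ e, Bad D d e) ∨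
      ∃ j : F → D, Function.Injective j ∧ IndepSet L (range j) ∧
        ∀ x y, x ≠ y → Good d (j x) (j y))
    {P : Bundled.{w} L.Structure} (hP : P ∈ K) [Nonempty P] (π : P → A)
    (hπ : ∀ a, IndepSet L (π ⁻¹' {a})) :
    ∃ C ∈ K, ∃ π' : C → A, ∀ d : Dat C, (∃ i e, (∀ x, π' (e x) = i) ∧ Bad C d e) ∨
      ∃ e : P ↪[L] C, (∀ p, π' (e p) = π p) ∧
        ∀ x y, x ≠ y → π x = π y → Good d (e x) (e y) := by
  classical
  have key : ∀ T : Finset A, ∃ C ∈ K, ∃ π' : C → A, Nonempty C ∧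
      (∀ a ∉ T, IndepSet L (π' ⁻¹' {a})) ∧
      ∀ d : Dat C, (∃ i e, (∀ x, π' (e x) = i) ∧ Bad C d e) ∨
        ∃ e : P ↪[L] C, (∀ p, π' (e p) = π p) ∧
          ∀ x y, x ≠ y → π x = π y → π x ∈ T → Good d (e x) (e y) := by
    intro T
    induction T using Finset.induction_on with
    | empty =>
      exact ⟨P, hP, π, inferInstance, fun a _ => hπ a, fun d =>
        Or.inr ⟨Embedding.refl L P, fun _ => rfl, by simp⟩⟩
    | insert i T hiT ih =>
      obtain ⟨P', hP', π₁, hne, hind, hcol⟩ := ih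
      have := hK.finite hP'
      obtain ⟨D, hDK, hDne, hDcol⟩ := hD {p // π₁ p = i}
      obtain ⟨C, hC, π₂, δ, hδ, hindep, hatt⟩ :=
        hfree.exists_partite_step hK htrans hP' hDK π₁ i (hind i hiT)
      refine ⟨C, hC, π₂, hDne.map δ, fun a ha => ?_, fun d => ?_⟩
      · rw [Finset.mem_insert, not_or] at ha
        exact hindep a ha.1 (hind a ha.2)
      rcases hDcol (pull δ d) with ⟨e, he⟩ | ⟨j, hj, hj', hjd⟩
      · exact Or.inl ⟨i, δ.comp e, fun x => hδ (e x), hbad _ _ _ _ _ he⟩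
      obtain ⟨ε, hε, hεj⟩ := hatt j hj hj'
      rcases hcol (pull ε d) with ⟨a, e, ha, he⟩ | ⟨e, he, hed⟩
      · exact Or.inl ⟨a, ε.comp e, fun x => (hε (e x)).trans (ha x), hbad _ _ _ _ _ he⟩
      refine Or.inr ⟨ε.comp e, fun p => (hε (e p)).trans (he p), fun x y hxy hπxy hx => ?_⟩
      rcases Finset.mem_insert.1 hx with hx | hx
      · have hex : π₁ (e x) = i := (he x).trans hx
        have hey : π₁ (e y) = i := (he y).trans (hπxy.symm.trans hx)
        have hne : (⟨e x, hex⟩ : {p // π₁ p = i}) ≠ ⟨e y, hey⟩ := fun h =>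
          hxy (e.injective (congrArg Subtype.val h))
        have := hgood _ _ _ _ (hjd _ _ hne)
        rwa [← hεj, ← hεj] at this
      · exact hgood ε d (e x) (e y) (hed x y hxy hπxy hx)
  have := Fintype.ofFinite A
  obtain ⟨C, hC, π', -, -, h⟩ := key Finset.univ
  exact ⟨C, hC, π', fun d => (h d).imp_right fun ⟨e, he, hed⟩ =>
    ⟨e, he, fun x y hxy hπxy => hed x y hxy hπxy (Finset.mem_univ _)⟩⟩

end Gluing

section Ramsey

/-- If the product of the set of colours with `F` is coloured, then some colour class contains a
copy of `F`. -/
theorem exists_monochromatic_embedding {Q F : Type*} [Finite Q] [Nonempty Q] [Finite F]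
    (col : Q × F → Q) : ∃ (q : Q) (g : F ↪ Q × F), ∀ x, col (g x) = q := by
  classical
  have := Fintype.ofFinite Q
  have := Fintype.ofFinite F
  obtain ⟨q, hq⟩ := Fintype.exists_le_card_fiber_of_mul_le_card (n := Fintype.card F) col
    (Fintype.card_prod Q F).ge
  rw [← Fintype.card_subtype] at hq
  obtain ⟨g⟩ := Function.Embedding.nonempty_of_card_le hq
  exact ⟨q, g.trans (Function.Embedding.subtype _), fun x => (g x).2⟩

/-- The lines of the cube `B → Fin d`: a direction together with the remaining coordinates. -/
abbrev CubeLine (B : Type*) (d : ℕ) : Type _ := Σ b : B, {c : B // c ≠ b} → Fin d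

/-- The line in direction `b` through a point of the cube. -/
abbrev cubeLine {B : Type*} {d : ℕ} (x : B → Fin d) (b : B) : CubeLine B d := ⟨b, fun c => x c⟩

theorem cubeLine_eq_iff {B : Type*} {d : ℕ} {x y : B → Fin d} {b : B} :
    cubeLine x b = cubeLine y b ↔ ∀ c, c ≠ b → x c = y c := by
  simp [funext_iff]

/-- If every line of a sufficiently large cube has, for each colour and each direction, at most
one line in that direction in conflict with it, then there is a point such that no two of the
lines through it are in conflict. -/
theorem exists_cube_point_without_conflict {B Q : Type*} [Finite B] [Finite Q] {d : ℕ}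
    (hd : Nat.card Q * Nat.card B * Nat.card B < d)
    (ρ : Q → CubeLine B d → CubeLine B d → Prop)
    (hρ : ∀ r l m m', m.1 = m'.1 → ρ r l m → ρ r l m' → m = m') :
    ∃ x : B → Fin d, ∀ b c, b ≠ c → ∀ r, ¬ ρ r (cubeLine x b) (cubeLine x c) := by
  classical
  have := Fintype.ofFinite B
  have := Fintype.ofFinite Q
  by_contra! hcon
  choose b c hbc r hr using hcon
  have hinj : Function.Injective fun x => (r x, c x, cubeLine x (b x)) := by
    intro x y hxy
    simp only [Prod.mk.injEq] at hxy
    obtain ⟨h₁, h₂, h₃⟩ := hxy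
    have hb : b x = b y := congrArg Sigma.fst h₃
    have hy := hr y
    rw [← h₁, ← h₂, ← h₃] at hy
    have h₄ := cubeLine_eq_iff.1 (hρ _ _ (cubeLine x (c x)) (cubeLine y (c x)) rfl (hr x) hy)
    rw [← hb] at h₃
    have h₅ := cubeLine_eq_iff.1 h₃
    funext a
    by_cases ha : a = b x
    · exact h₄ a (ha ▸ hbc x)
    · exact h₅ a ha
  have hcard := Fintype.card_le_of_injective _ hinj
  rcases isEmpty_or_nonempty B with hB | ⟨⟨b₀⟩⟩
  · exact hB.elim (b hB.elim)
  simp only [Nat.card_eq_fintype_card] at hd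
  have hpos : 0 < Fintype.card B := Fintype.card_pos_iff.2 ⟨b₀⟩
  have hsub : ∀ a : B, Fintype.card {c : B // c ≠ a} = Fintype.card B - 1 := by simp
  simp only [Fintype.card_prod, Fintype.card_sigma, Fintype.card_fun, Fintype.card_fin,
    hsub, Finset.sum_const, Finset.card_univ, smul_eq_mul] at hcard
  obtain ⟨m, hm⟩ : ∃ m, Fintype.card B = m + 1 := ⟨_, (Nat.succ_pred_eq_of_pos hpos).symm⟩
  rw [hm, Nat.add_sub_cancel] at hcard
  rw [hm] at hd
  have hdpos : 0 < d ^ m := Nat.pow_pos (by omega)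
  have := Nat.mul_lt_mul_of_pos_right hd hdpos
  rw [pow_succ'] at hcard
  exact absurd hcard (not_le.2 (by simpa [mul_assoc] using this))

/-- A family of conflict relations, such that two points in conflict with a common point by the
same relation are in conflict with each other. -/
structure IsConflict {Q X : Type*} (ρ : Q → X → X → Prop) : Prop where
  refl : ∀ r x, ρ r x x
  sep : ∀ r x y z, ρ r x y → ρ r x z → ∃ r', ρ r' y z

variable {L : FirstOrder.Language.{u, v}} [L.IsRelational] {K : Set (Bundled.{w} L.Structure)}

/-- Transitive free amalgamation classes have the vertex-Ramsey property. -/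
theorem HasFreeAmalgamation.vertexRamsey (hK : IsFraisse K) (hfree : HasFreeAmalgamation L K)
    (htrans : TransitiveClass L K) {B : Bundled.{w} L.Structure} (hB : B ∈ K) [Nonempty B]
    (Q : Type w) [Finite Q] [Nonempty Q] :
    ∃ E ∈ K, ∀ χ : E → Q, ∃ (e : B ↪[L] E) (q : Q), ∀ x, χ (e x) = q := by
  classical
  have := hK.finite hB
  obtain ⟨b₀⟩ := ‹Nonempty B›
  obtain ⟨q₀⟩ := ‹Nonempty Q›
  let g₀ : B ↪ Q × B := ⟨Prod.mk q₀, Prod.mk_right_injective q₀⟩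
  have : Nonempty (B ↪ Q × B) := ⟨g₀⟩
  obtain ⟨G, hG, hrel, hcov⟩ := hfree.exists_disjoint_copies hK hB (B ↪ Q × B)
  let P : Bundled.{w} L.Structure := ⟨(B ↪ Q × B) × B, G⟩
  have : Nonempty P := ⟨(g₀, b₀)⟩
  obtain ⟨C, hC, π, hπ⟩ := hfree.exists_partite hK htrans (A := Q × B) (B := B)
    (fun X => X → Q) (fun f d => d ∘ f) (fun d x y => d x = d y) (fun _ _ _ => False)
    (fun _ _ _ _ h => h) (fun _ _ _ _ _ h => h)
    (by
      intro F _
      obtain ⟨G', hG', -, hcov'⟩ := hfree.exists_disjoint_copies hK hB (Q × Option F)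
      refine ⟨_, hG', ⟨((q₀, none), b₀)⟩, fun d => Or.inr ?_⟩
      obtain ⟨q, g, hg⟩ := exists_monochromatic_embedding fun c : Q × Option F => d (c, b₀)
      refine ⟨fun x => (g (some x), b₀), fun x y h => ?_, ?_, fun x y _ => ?_⟩
      · exact Option.some_injective _ (g.injective (Prod.ext_iff.1 h).1)
      · intro n R t ht hR k l
        obtain ⟨c, s, rfl⟩ := hcov' n R t hR
        obtain ⟨x, hx⟩ := ht k
        obtain ⟨y, hy⟩ := ht l
        exact Prod.ext rfl ((Prod.ext_iff.1 hx).2.symm.trans (Prod.ext_iff.1 hy).2)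
      · exact (hg _).trans (hg _).symm)
    (P := P) hG (fun p => p.1 p.2)
    (by
      intro a n R t ht hR k l
      obtain ⟨g, s, rfl⟩ := hcov n R t hR
      exact Prod.ext rfl (g.injective ((ht k).trans (ht l).symm)))
  refine ⟨C, hC, fun χ => ?_⟩
  obtain ⟨_, _, _, h⟩ | ⟨e, -, he⟩ := hπ χ
  · exact h.elim
  obtain ⟨q, g, hg⟩ := exists_monochromatic_embedding fun a : Q × B =>
    if h : ∃ p : P, p.1 p.2 = a then χ (e h.choose) else q₀
  refine ⟨e.comp (embeddingOfRelMapIff (V := P) (Prod.mk g) (Prod.mk_right_injective g) (hrel g)),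
    q, fun x => ?_⟩
  have hx : ∃ p : P, p.1 p.2 = g x := ⟨(g, x), rfl⟩
  rw [← hg x, dif_pos hx]
  by_cases hne : ((g, x) : P) = hx.choose
  · exact congrArg (fun p => χ (e p)) hne
  · exact he _ _ hne hx.choose_spec.symm

/-- A member of the class in which every family of conflict relations has either a common
conflict with all points of a copy of `B`, or an arbitrarily large conflict-free independent
set. -/
theorem HasFreeAmalgamation.exists_conflictFree_indepSet (hK : IsFraisse K)
    (hfree : HasFreeAmalgamation L K) (htrans : TransitiveClass L K)
    {B : Bundled.{w} L.Structure} (hB : B ∈ K) [Nonempty B] (Q : Type) [Finite Q]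
    (F : Type w) [Finite F] :
    ∃ D ∈ K, Nonempty D ∧ ∀ ρ : Q → D → D → Prop, IsConflict ρ →
      (∃ (e : B ↪[L] D) (r : Q) (c : D), ∀ x, ρ r c (e x)) ∨
      ∃ j : F → D, Function.Injective j ∧ IndepSet L (range j) ∧
        ∀ x y, x ≠ y → ∀ r, ¬ ρ r (j x) (j y) := by
  classical
  obtain ⟨E, hE, hχ⟩ := hfree.vertexRamsey hK htrans hB (Option (Q × Option F))
  obtain ⟨e₀, -⟩ := hχ fun _ => none
  obtain ⟨b₀⟩ := ‹Nonempty B›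
  obtain ⟨G, hG, hrel, hcov⟩ := hfree.exists_disjoint_copies hK hE (Option F)
  refine ⟨_, hG, ⟨(none, e₀ b₀)⟩, fun ρ hρ => ?_⟩
  by_cases hbad : ∃ (e : B ↪[L] (⟨Option F × E, G⟩ : Bundled.{w} L.Structure)) (r : Q)
      (c : Option F × E), ∀ x, ρ r c (e x)
  · exact Or.inl hbad
  right
  have greedy : ∀ T : Finset (Option F), ∃ c : Option F → E,
      ∀ x ∈ T, ∀ y ∈ T, x ≠ y → ∀ r, ¬ ρ r (x, c x) (y, c y) := by
    intro T
    induction T using Finset.induction_on with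
    | empty => exact ⟨fun _ => e₀ b₀, by simp⟩
    | insert a T haT ih =>
      obtain ⟨c, hc⟩ := ih
      obtain ⟨z, hz⟩ : ∃ z : E, ∀ y ∈ T, ∀ r, ¬ ρ r (y, c y) (a, z) := by
        by_contra! hcon
        choose y hy r hr using hcon
        obtain ⟨e, q, he⟩ := hχ fun z => some (r z, y z)
        refine hbad ⟨(embeddingOfRelMapIff (Prod.mk a) (Prod.mk_right_injective a)
          (hrel a) : E ↪[L] (⟨Option F × E, G⟩ : Bundled.{w} L.Structure)).comp e,
          r (e b₀), (y (e b₀), c (y (e b₀))), fun x => ?_⟩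
        have hx := Option.some_injective _ ((he x).trans (he b₀).symm)
        rw [Prod.mk.injEq] at hx
        rw [← hx.1, ← hx.2]
        exact hr (e x)
      refine ⟨Function.update c a z, ?_⟩
      have hne : ∀ y ∈ T, Function.update c a z y = c y := fun y hy =>
        Function.update_of_ne (ne_of_mem_of_not_mem hy haT) _ _
      intro x hx y hy hxy r
      rcases Finset.mem_insert.1 hx with rfl | hxT
      · rcases Finset.mem_insert.1 hy with rfl | hyT
        · exact absurd rfl hxy
        · rw [hne y hyT, Function.update_self]
          intro h
          obtain ⟨r', hr'⟩ := hρ.sep _ _ _ _ h (hρ.refl r _)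
          exact hz y hyT r' hr'
      · rcases Finset.mem_insert.1 hy with rfl | hyT
        · rw [hne x hxT, Function.update_self]
          exact hz x hxT r
        · rw [hne x hxT, hne y hyT]
          exact hc x hxT y hyT hxy r
  have := Fintype.ofFinite F
  obtain ⟨c, hc⟩ := greedy Finset.univ
  refine ⟨fun x => (some x, c (some x)), fun x y h => ?_, ?_, fun x y hxy => ?_⟩
  · exact Option.some_injective _ (Prod.ext_iff.1 h).1
  · intro n R t ht hR k l
    obtain ⟨a, s, rfl⟩ := hcov n R t hR
    obtain ⟨x, hx⟩ := ht k
    obtain ⟨y, hy⟩ := ht l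
    have hxy : some x = some y := (Prod.ext_iff.1 hx).1.trans (Prod.ext_iff.1 hy).1.symm
    rw [← hx, ← hy, Option.some_injective _ hxy]
  · exact hc _ (Finset.mem_univ _) _ (Finset.mem_univ _) (by simpa using hxy)

/-- The hypergraph of lines through points of a cube, with a copy of `B` on each point. -/
theorem HasFreeAmalgamation.exists_cube (hK : IsFraisse K) (hfree : HasFreeAmalgamation L K)
    {B : Bundled.{w} L.Structure} (hB : B ∈ K) {d : ℕ} (hd : 0 < d) :
    ∃ G : L.Structure (CubeLine B d), (⟨CubeLine B d, G⟩ : Bundled.{w} L.Structure) ∈ K ∧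
      (∀ (x : B → Fin d) (n : ℕ) (R : L.Relations n) (s : Fin n → B),
        Structure.RelMap R (cubeLine x ∘ s) ↔ Structure.RelMap R s) ∧
      ∀ (n : ℕ) (R : L.Relations n) (t : Fin n → CubeLine B d), Structure.RelMap R t →
        ∃ (x : B → Fin d) (s : Fin n → B), t = cubeLine x ∘ s := by
  classical
  have := hK.finite hB
  refine hfree.exists_glued hK (fun _ : B → Fin d => B) (fun _ => hB) cubeLine ?_ ?_ ?_
  · rintro ⟨b, y⟩
    refine ⟨fun c => if h : c ≠ b then y ⟨c, h⟩ else ⟨0, hd⟩, b, ?_⟩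
    simp only [cubeLine, Sigma.mk.injEq, heq_eq_eq, true_and]
    funext c
    exact dif_pos c.2
  · intro x y n R s t hst
    have : s = t := funext fun k => congrArg Sigma.fst (hst k)
    exact fun h => this ▸ h
  · intro S hS
    have hagree : ∀ l ∈ S, ∀ m ∈ S, ∀ (c : B) (hl : c ≠ l.1) (hm : c ≠ m.1),
        l.2 ⟨c, hl⟩ = m.2 ⟨c, hm⟩ := by
      intro l hl m hm c
      obtain ⟨x, ⟨a, rfl⟩, ⟨b, rfl⟩⟩ := hS l hl m hm
      exact fun _ _ => rfl
    refine ⟨fun c => if h : ∃ l ∈ S, c ≠ l.1 then h.choose.2 ⟨c, h.choose_spec.2⟩ else ⟨0, hd⟩,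
      ?_⟩
    rintro ⟨b, y⟩ hl
    refine ⟨b, ?_⟩
    simp only [cubeLine, Sigma.mk.injEq, heq_eq_eq, true_and]
    funext c
    have h : ∃ l ∈ S, c.1 ≠ l.1 := ⟨_, hl, c.2⟩
    rw [dif_pos h]
    exact hagree _ h.choose_spec.1 _ hl c _ _

/-- Transitive free amalgamation classes are canonically vertex-Ramsey with respect to families
of conflict relations. -/
theorem HasFreeAmalgamation.exists_conflict_ramsey (hK : IsFraisse K)
    (hfree : HasFreeAmalgamation L K) (htrans : TransitiveClass L K)
    {B : Bundled.{w} L.Structure} (hB : B ∈ K) [Nonempty B] (Q : Type) [Finite Q] :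
    ∃ C ∈ K, ∃ π : C → B, ∀ ρ : Q → C → C → Prop, IsConflict ρ →
      (∃ (i : B) (e : B ↪[L] C), (∀ x, π (e x) = i) ∧ ∃ (r : Q) (c : C), ∀ x, ρ r c (e x)) ∨
      ∃ e : B ↪[L] C, (∀ x, π (e x) = x) ∧ ∀ x y, x ≠ y → ∀ r, ¬ ρ r (e x) (e y) := by
  have := hK.finite hB
  obtain ⟨d, hd⟩ := exists_gt (Nat.card Q * Nat.card B * Nat.card B)
  have hd0 : 0 < d := (Nat.zero_le _).trans_lt hd
  obtain ⟨G, hG, hrel, hcov⟩ := hfree.exists_cube hK hB hd0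
  let P : Bundled.{w} L.Structure := ⟨CubeLine B d, G⟩
  have : Nonempty P := ‹Nonempty B›.map (cubeLine fun _ => ⟨0, hd0⟩)
  obtain ⟨C, hC, π, hπ⟩ := hfree.exists_partite hK htrans (A := B) (B := B)
    (fun X => {ρ : Q → X → X → Prop // IsConflict ρ})
    (fun f ρ => ⟨fun r x y => ρ.1 r (f x) (f y),
      ⟨fun r x => ρ.2.refl r _, fun r x y z => ρ.2.sep r _ _ _⟩⟩)
    (fun ρ x y => ∀ r, ¬ ρ.1 r x y)
    (fun C ρ e => ∃ (r : Q) (c : C), ∀ x, ρ.1 r c (e x))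
    (fun _ _ _ _ h => h) (fun _ _ ε _ _ ⟨r, c, h⟩ => ⟨r, ε c, h⟩)
    (fun F _ => by
      obtain ⟨D, hD, hne, h⟩ := hfree.exists_conflictFree_indepSet hK htrans hB Q F
      exact ⟨D, hD, hne, fun ρ => h ρ.1 ρ.2⟩)
    (P := P) hG Sigma.fst
    (by
      intro a n R t ht hR k l
      obtain ⟨x, s, rfl⟩ := hcov n R t hR
      exact congrArg (cubeLine x) ((ht k).trans (ht l).symm))
  refine ⟨C, hC, π, fun ρ hρ => (hπ ⟨ρ, hρ⟩).imp_right ?_⟩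
  rintro ⟨e, he, hgood⟩
  obtain ⟨x, hx⟩ := exists_cube_point_without_conflict hd (fun r l m => ρ r (e l) (e m)) (by
    intro r l m m' hm h h'
    by_contra hne
    obtain ⟨r', hr'⟩ := hρ.sep _ _ _ _ h h'
    exact hgood m m' hne hm r' hr')
  exact ⟨e.comp (embeddingOfRelMapIff (V := P) (cubeLine x)
    (fun a b h => congrArg Sigma.fst h) (hrel x)), fun b => he _, hx⟩

theorem HasFreeAmalgamation.veryCanonicalVertexRamsey (hK : IsFraisse K)
    (hfree : HasFreeAmalgamation L K) (htrans : TransitiveClass L K) :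
    VeryCanonicalVertexRamsey L K := by
  intro s _ B hB
  have := hK.finite hB
  let φ := Finite.equivFin B
  rcases isEmpty_or_nonempty B with hBe | hBne
  · exact ⟨B, hB, φ, fun χ => Or.inr ⟨Embedding.refl L B, φ.bijective,
      fun r x => hBe.elim x⟩⟩
  obtain ⟨C, hC, π, hπ⟩ := hfree.exists_conflict_ramsey hK htrans hB (Fin s)
  refine ⟨C, hC, φ ∘ π, fun χ => ?_⟩
  rcases hπ (fun r x y => χ r x = χ r y)
    ⟨fun _ _ => rfl, fun r x y z hxy hxz => ⟨r, hxy.symm.trans hxz⟩⟩ with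
    ⟨i, e, he, r, c, hc⟩ | ⟨e, he, hne⟩
  · exact Or.inl ⟨r, φ i, e, fun x => congrArg φ (he x), fun x y => (hc x).symm.trans (hc y)⟩
  · refine Or.inr ⟨e, ?_, fun r x y hxy => ?_⟩
    · simpa [he] using φ.bijective
    · by_contra h
      exact hne x y h r hxy

/-- The sunflower property for families of `k`-sets indexed by a member of the class. -/
theorem HasFreeAmalgamation.exists_sunflower (hK : IsFraisse K)
    (hfree : HasFreeAmalgamation L K) (htrans : TransitiveClass L K) (k : ℕ)
    {B : Bundled.{w} L.Structure} (hB : B ∈ K) :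
    ∃ C ∈ K, Nonempty (B ↪[L] C) ∧ ∀ (α : Type x) (S : C → Finset α), (∀ v, (S v).card = k) →
      ∃ (e : B ↪[L] C) (c : Set α), ∀ a b : B, a ≠ b →
        (S (e a) : Set α) ∩ (S (e b) : Set α) = c := by
  classical
  rcases isEmpty_or_nonempty B with hBe | hBne
  · exact ⟨B, hB, ⟨Embedding.refl L B⟩, fun α S _ =>
      ⟨Embedding.refl L B, ∅, fun a => hBe.elim a⟩⟩
  induction k with
  | zero =>
    refine ⟨B, hB, ⟨Embedding.refl L B⟩, fun α S hS => ⟨Embedding.refl L B, ∅, fun a b _ => ?_⟩⟩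
    simp [Finset.card_eq_zero.1 (hS _)]
  | succ k ih =>
    obtain ⟨B', hB', ⟨ι⟩, hsun⟩ := ih
    have : Nonempty B' := hBne.map ι
    obtain ⟨C, hC, π, hπ⟩ := hfree.exists_conflict_ramsey hK htrans hB' (Fin (k + 1))
    refine ⟨C, hC, ?_, fun α S hS => ?_⟩
    · rcases hπ (fun _ _ _ => True) ⟨fun _ _ => trivial, fun r _ _ _ _ _ => ⟨r, trivial⟩⟩ with
        ⟨_, e, _⟩ | ⟨e, _⟩ <;> exact ⟨e.comp ι⟩
    · let elt : C → Fin (k + 1) → α := fun v r => ((S v).equivFinOfCardEq (hS v)).symm r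
      have elt_mem : ∀ v r, elt v r ∈ S v := fun v r => Subtype.prop _
      have exists_elt : ∀ v, ∀ a ∈ S v, ∃ r, elt v r = a := fun v a ha =>
        ⟨(S v).equivFinOfCardEq (hS v) ⟨a, ha⟩, by simp [elt]⟩
      have hconf : IsConflict fun r v w => elt v r ∈ S w := by
        refine ⟨fun r v => elt_mem v r, fun r u v w hv hw => ?_⟩
        obtain ⟨r', hr'⟩ := exists_elt v _ hv
        exact ⟨r', hr'.symm ▸ hw⟩
      rcases hπ _ hconf with
        ⟨-, e, -, r, c, hc⟩ | ⟨e, -, he⟩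
      · obtain ⟨e', core, hcore⟩ := hsun α (fun v => (S (e v)).erase (elt c r)) fun v => by
          rw [Finset.card_erase_of_mem (hc v), hS, Nat.add_sub_cancel]
        refine ⟨e.comp e', insert (elt c r) core, fun a b hab => ?_⟩
        rw [← hcore a b hab]
        ext z
        by_cases hz : z = elt c r
        · subst hz
          simp [hc]
        · simp [hz]
      · refine ⟨e.comp ι, ∅, fun a b hab => ?_⟩
        refine eq_empty_of_forall_notMem fun z hz => ?_
        obtain ⟨r, hr⟩ := exists_elt _ z hz.1
        exact he (ι a) (ι b) (ι.injective.ne hab) r (hr.symm ▸ hz.2)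

end Ramsey

/-- A transitive free amalgamation class over a countable relational language has the
very canonical vertex-Ramsey property, and hence the finite sunflower property. -/
theorem statement16 (L : FirstOrder.Language.{u, v}) [L.IsRelational]
    [Countable L.Symbols] (K : Set (Bundled.{w} L.Structure))
    (hK : IsFraisse K) (hfree : HasFreeAmalgamation L K)
    (htrans : TransitiveClass L K) :
    VeryCanonicalVertexRamsey L K ∧
      ∀ k : ℕ, 1 ≤ k → FiniteKSunflowerProperty.{u, v, w, x} L K k := by
  refine ⟨hfree.veryCanonicalVertexRamsey hK htrans, fun k _ B hB => ?_⟩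
  obtain ⟨C, hC, -, hsun⟩ := hfree.exists_sunflower hK htrans k hB
  refine ⟨C, hC, fun α X hX _ ⟨φ⟩ => ?_⟩
  obtain ⟨e, c, h⟩ := hsun α (fun v => (φ v : Finset α)) fun v => hX _ (φ v).2
  exact ⟨φ.toEmbedding.comp e, c, h⟩
end
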